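/- arXiv:2212.05809 — 4 statements merged into one kernel-verified Lean document; each statement's English description precedes it below -/
import Mathlib

section
/- Let (u, b, p) be a smooth bounded solution of the stationary MHD/Hall–MHD system with parameter δ ∈ [0,1] on the slab ℝ²×𝕋 whose radial components u^r and b^r are axisymmetric, and let Y(R) = ∫_{ℝ²×[0,1]} (|∇u|² + |∇b|²) φ_R dx. Then there exists a constant C > 0, independent of R, such that Y(R) ≤ C R^{1/2} (Y'(R))^{1/2} for all R ≥ 2. -/
open MeasureTheory

noncomputable section

/-- Points of `ℝ³`. -/
abbrev V3 : Type := Fin 3 → ℝ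

/-- Partial derivative `∂ᵢ f`. -/
def pd (i : Fin 3) (f : V3 → ℝ) (x : V3) : ℝ := fderiv ℝ f x (Pi.single i 1)

/-- Componentwise Laplacian. -/
def lap (f : V3 → ℝ) (x : V3) : ℝ := ∑ i, pd i (pd i f) x

/-- Cross product in `ℝ³`. -/
def cross3 (a c : V3) : V3 :=
  ![a 1 * c 2 - a 2 * c 1, a 2 * c 0 - a 0 * c 2, a 0 * c 1 - a 1 * c 0]

/-- Curl of a vector field. -/
def curl (b : V3 → V3) (x : V3) : V3 :=
  ![pd 1 (fun y => b y 2) x - pd 2 (fun y => b y 1) x,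
    pd 2 (fun y => b y 0) x - pd 0 (fun y => b y 2) x,
    pd 0 (fun y => b y 1) x - pd 1 (fun y => b y 0) x]

/-- Euclidean dot product in `ℝ³`. -/
def dot3 (a c : V3) : ℝ := ∑ i, a i * c i

/-- `|x'| = √(x₁² + x₂²)`. -/
def nr (x : V3) : ℝ := Real.sqrt ((x 0) ^ 2 + (x 1) ^ 2)

/-- The slab `ℝ² × [0,1]`. -/
def slab : Set V3 := {x | 0 ≤ x 2 ∧ x 2 ≤ 1}

/-- The region `{|x'| ≤ R} × [0,1]`. -/
def cylSet (R : ℝ) : Set V3 := {x | (0 ≤ x 2 ∧ x 2 ≤ 1) ∧ nr x ≤ R}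

/-- The annular region `O_R = {R-1 ≤ |x'| ≤ R} × [0,1]`. -/
def OR (R : ℝ) : Set V3 := {x | (0 ≤ x 2 ∧ x 2 ≤ 1) ∧ R - 1 ≤ nr x ∧ nr x ≤ R}

/-- The radial cut-off function `φ_R`. -/
def phiR (R : ℝ) (x : V3) : ℝ := min 1 (max 0 (R - nr x))

/-- `|∇u|² = Σ_{i,j} |∂ᵢ uʲ|²`. -/
def gradSq (u : V3 → V3) (x : V3) : ℝ := ∑ i, ∑ j, (pd i (fun y => u y j) x) ^ 2

/-- The `L²` norm of a scalar function on a set. -/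
def l2 (f : V3 → ℝ) (S : Set V3) : ℝ := Real.sqrt (∫ x in S, (f x) ^ 2)

/-- The radial component `u^r` as a function of `x`. -/
def ur (u : V3 → V3) (x : V3) : ℝ := (x 0 * u x 0 + x 1 * u x 1) / nr x

/-- The point with cylindrical coordinates `(r, θ, z)`. -/
def cylPt (r θ z : ℝ) : V3 := ![r * Real.cos θ, r * Real.sin θ, z]

/-- The radial component `u^r` in cylindrical coordinates. -/
def compR (u : V3 → V3) (r θ z : ℝ) : ℝ :=
  Real.cos θ * u (cylPt r θ z) 0 + Real.sin θ * u (cylPt r θ z) 1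

/-- The swirl component `u^θ` in cylindrical coordinates. -/
def compTheta (u : V3 → V3) (r θ z : ℝ) : ℝ :=
  -Real.sin θ * u (cylPt r θ z) 0 + Real.cos θ * u (cylPt r θ z) 1

/-- A cylindrical component is axisymmetric if it is independent of `θ`. -/
def AxiSym (f : ℝ → ℝ → ℝ → ℝ) : Prop := ∀ r θ₁ θ₂ z, f r θ₁ z = f r θ₂ z

/-- `1`-periodicity in the `x₃` variable. -/
def PeriodicZ (u : V3 → V3) : Prop := ∀ x : V3, u ![x 0, x 1, x 2 + 1] = u x

/-- Divergence-free vector field. -/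
def DivFree (u : V3 → V3) : Prop := ∀ x, ∑ i, pd i (fun y => u y i) x = 0

/-- Boundedness of a vector field. -/
def Bounded3 (u : V3 → V3) : Prop := ∃ M, ∀ x, ‖u x‖ ≤ M

/-- The stationary MHD (`δ = 0`) / Hall–MHD (`δ = 1`) system:
`(u·∇)u + ∇p − (b·∇)b − Δu = 0`,
`(u·∇)b − (b·∇)u − Δb = δ ∇×((∇×b)×b)`, `div u = div b = 0`. -/
def IsMHD (δ : ℝ) (u b : V3 → V3) (p : V3 → ℝ) : Prop :=
  (∀ x i, (∑ j, u x j * pd j (fun y => u y i) x) + pd i p x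
      - (∑ j, b x j * pd j (fun y => b y i) x) - lap (fun y => u y i) x = 0) ∧
  (∀ x i, (∑ j, u x j * pd j (fun y => b y i) x)
      - (∑ j, b x j * pd j (fun y => u y i) x) - lap (fun y => b y i) x
      = δ * curl (fun y => cross3 (curl b y) (b y)) x i) ∧
  DivFree u ∧ DivFree b

/-- Growth of the local Dirichlet integral: `∫_{{|x'|≤R}×[0,1]} |∇u|²+|∇b|² ≤ C R^α`. -/
def DirichletGrowth (u b : V3 → V3) : Prop :=
  ∃ C > (0:ℝ), ∃ α > (0:ℝ), ∀ R > (1:ℝ),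
    (∫ x in cylSet R, (gradSq u x + gradSq b x)) ≤ C * R ^ α

/-- Radial derivative `∂_r f = (x'/|x'|)·(∂₁f, ∂₂f)`. -/
def radD (f : V3 → ℝ) (x : V3) : ℝ := (x 0 / nr x) * pd 0 f x + (x 1 / nr x) * pd 1 f x

/-- The unit radial vector `(x'/|x'|, 0)`. -/
def er3 (x : V3) : V3 := ![x 0 / nr x, x 1 / nr x, 0]

/-- Squared Euclidean length of a vector of `ℝ³`. -/
def sq3 (v : V3) : ℝ := ∑ i, (v i) ^ 2

/-- Differentiation under the integral sign for a jointly smooth integrand on `[0,1]`. -/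
lemma hasFDerivAt_param {E : Type} [NormedAddCommGroup E] [NormedSpace ℝ E] [CompleteSpace E]
    {g : V3 → ℝ → E} (hg : ContDiff ℝ (⊤ : ℕ∞) (fun q : V3 × ℝ => g q.1 q.2)) (x : V3) :
    HasFDerivAt (fun y => ∫ t in (0:ℝ)..1, g y t)
      (∫ t in (0:ℝ)..1, fderiv ℝ (fun y => g y t) x) x := by
  have hd : ContDiff ℝ (⊤ : ℕ∞) (fun q : V3 × ℝ => fderiv ℝ (fun y => g y q.2) q.1) := by
    refine ContDiff.fderiv (m := (⊤ : ℕ∞)) (n := (⊤ : ℕ∞))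
      (f := fun (q : V3 × ℝ) y => g y q.2) ?_ contDiff_fst (by simp)
    exact hg.comp (contDiff_snd.prodMk (contDiff_snd.comp contDiff_fst))
  obtain ⟨K, hK⟩ := ((isCompact_closedBall x 1).prod
    (isCompact_Icc (a := (0:ℝ)) (b := 1))).exists_bound_of_continuousOn
    hd.continuous.continuousOn
  refine (intervalIntegral.hasFDerivAt_integral_of_dominated_of_fderiv_le
    (F := fun y t => g y t) (F' := fun y t => fderiv ℝ (fun y => g y t) y)
    (bound := fun _ => K) (Metric.ball_mem_nhds x one_pos) ?_ ?_ ?_ ?_ ?_ ?_)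
  · refine Filter.Eventually.of_forall fun y => ?_
    exact (hg.continuous.comp (Continuous.prodMk_right y)).aestronglyMeasurable
  · exact (hg.continuous.comp (Continuous.prodMk_right x)).intervalIntegrable _ _
  · exact (hd.continuous.comp (Continuous.prodMk_right x)).aestronglyMeasurable
  · refine Filter.Eventually.of_forall fun t ht y hy => ?_
    rw [Set.uIoc_of_le zero_le_one] at ht
    exact hK (y, t) ⟨Metric.ball_subset_closedBall hy, ht.1.le, ht.2⟩
  · exact intervalIntegrable_const
  · refine Filter.Eventually.of_forall fun t ht y hy => ?_
    have h1 : ContDiff ℝ (⊤ : ℕ∞) (fun y => g y t) := hg.comp (contDiff_id.prodMk contDiff_const)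
    exact (h1.differentiable (by simp) y).hasFDerivAt

lemma contDiff_param {E : Type} [NormedAddCommGroup E] [NormedSpace ℝ E] [CompleteSpace E]
    {g : V3 → ℝ → E} (hg : ContDiff ℝ (⊤ : ℕ∞) (fun q : V3 × ℝ => g q.1 q.2)) :
    ContDiff ℝ (⊤ : ℕ∞) (fun y => ∫ t in (0:ℝ)..1, g y t) := by
  rw [contDiff_infty]
  intro n
  induction n generalizing E with
  | zero =>
    rw [Nat.cast_zero, contDiff_zero]
    exact continuous_iff_continuousAt.2 fun x => (hasFDerivAt_param hg x).continuousAt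
  | succ n ih =>
    rw [Nat.cast_succ, contDiff_succ_iff_hasFDerivAt]
    refine ⟨_, ih (g := fun y t => fderiv ℝ (fun y => g y t) y) ?_, hasFDerivAt_param hg⟩
    refine ContDiff.fderiv (m := (⊤ : ℕ∞)) (n := (⊤ : ℕ∞))
      (f := fun (q : V3 × ℝ) y => g y q.2) ?_ contDiff_fst (by simp)
    exact hg.comp (contDiff_snd.prodMk (contDiff_snd.comp contDiff_fst))

section PartialDerivatives

variable {f g : V3 → ℝ} {x : V3} (i : Fin 3)

lemma pd_add (hf : Differentiable ℝ f) (hg : Differentiable ℝ g) :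
    pd i (fun y => f y + g y) x = pd i f x + pd i g x := by
  simp only [pd]; rw [fderiv_fun_add (hf x) (hg x)]; rfl

lemma pd_sub (hf : Differentiable ℝ f) (hg : Differentiable ℝ g) :
    pd i (fun y => f y - g y) x = pd i f x - pd i g x := by
  simp only [pd]; rw [fderiv_fun_sub (hf x) (hg x)]; rfl

lemma pd_mul (hf : Differentiable ℝ f) (hg : Differentiable ℝ g) :
    pd i (fun y => f y * g y) x = f x * pd i g x + pd i f x * g x := by
  simp only [pd]; rw [fderiv_fun_mul (hf x) (hg x)]; simp [mul_comm]

lemma pd_const (c : ℝ) : pd i (fun _ => c) x = 0 := by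
  simp [pd]

lemma pd_coord (j : Fin 3) : pd i (fun y => y j) x = if j = i then 1 else 0 := by
  have : fderiv ℝ (fun y : V3 => y j) x = ContinuousLinearMap.proj j :=
    (ContinuousLinearMap.proj (R := ℝ) (φ := fun _ : Fin 3 => ℝ) j).fderiv
  simp [pd, this, Pi.single_apply]

lemma pd_comp {h : ℝ → ℝ} (hh : Differentiable ℝ h) (hf : Differentiable ℝ f) :
    pd i (fun y => h (f y)) x = deriv h (f x) * pd i f x := by
  simp only [pd]
  have : fderiv ℝ (fun y => h (f y)) x = deriv h (f x) • fderiv ℝ f x :=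
    ((hh (f x)).hasDerivAt.comp_hasFDerivAt x (hf x).hasFDerivAt).fderiv
  simp [this]

lemma pd_eq_deriv (hf : Differentiable ℝ f) :
    HasDerivAt (fun t : ℝ => f (x + t • Pi.single i 1)) (pd i f x) 0 := by
  have h1 : HasDerivAt (fun t : ℝ => x + t • (Pi.single i 1 : V3)) (Pi.single i 1) 0 := by
    simpa using ((hasDerivAt_id (0:ℝ)).smul_const (Pi.single i 1 : V3)).const_add x
  have h2 : HasFDerivAt f (fderiv ℝ f x) (x + (0:ℝ) • (Pi.single i 1 : V3)) := by
    simpa using (hf x).hasFDerivAt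
  exact h2.comp_hasDerivAt 0 h1

@[fun_prop]
lemma contDiff_pd (hf : ContDiff ℝ (⊤ : ℕ∞) f) : ContDiff ℝ (⊤ : ℕ∞) (pd i f) := by
  unfold pd
  exact (hf.fderiv_right (m := (⊤ : ℕ∞)) (by simp)).clm_apply contDiff_const

end PartialDerivatives

/-- Squared distance to the vertical axis. -/
def rho (x : V3) : ℝ := x 0 ^ 2 + x 1 ^ 2

@[fun_prop]
lemma contDiff_rho : ContDiff ℝ (⊤ : ℕ∞) rho := by unfold rho; fun_prop

lemma pd_rho (i : Fin 3) (x : V3) : pd i rho x = ![2 * x 0, 2 * x 1, 0] i := by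
  have : rho = fun y => y 0 * y 0 + y 1 * y 1 := by ext; simp [rho]; ring
  rw [this, pd_add i (by fun_prop) (by fun_prop), pd_mul i (by fun_prop) (by fun_prop),
    pd_mul i (by fun_prop) (by fun_prop)]
  fin_cases i <;> simp [pd_coord] <;> ring

/-- Vertical primitive `∫₀^{x₃} f(x₁, x₂, s) ds`. -/
def vprim (f : V3 → ℝ) (x : V3) : ℝ := ∫ s in (0:ℝ)..x 2, f ![x 0, x 1, s]

lemma vprim_eq (f : V3 → ℝ) (x : V3) :
    vprim f x = ∫ t in (0:ℝ)..1, x 2 * f ![x 0, x 1, t * x 2] := by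
  have := intervalIntegral.mul_integral_comp_mul_right (a := 0) (b := 1)
    (f := fun s => f ![x 0, x 1, s]) (x 2)
  simp only [zero_mul, one_mul] at this
  rw [vprim, ← this, intervalIntegral.integral_const_mul]

lemma contDiff_vec3 {E : Type} [NormedAddCommGroup E] [NormedSpace ℝ E] {a b c : E → ℝ}
    (ha : ContDiff ℝ (⊤ : ℕ∞) a)
    (hb : ContDiff ℝ (⊤ : ℕ∞) b) (hc : ContDiff ℝ (⊤ : ℕ∞) c) :
    ContDiff ℝ (⊤ : ℕ∞) (fun y => (![a y, b y, c y] : V3)) := by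
  rw [contDiff_pi]
  intro i
  fin_cases i <;> simpa

lemma contDiff_vprim_integrand {f : V3 → ℝ} (hf : ContDiff ℝ (⊤ : ℕ∞) f) :
    ContDiff ℝ (⊤ : ℕ∞) (fun q : V3 × ℝ => q.1 2 * f ![q.1 0, q.1 1, q.2 * q.1 2]) :=
  ContDiff.mul (by fun_prop)
    (hf.comp (contDiff_vec3 (by fun_prop) (by fun_prop) (by fun_prop)))

@[fun_prop]
lemma contDiff_vprim {f : V3 → ℝ} (hf : ContDiff ℝ (⊤ : ℕ∞) f) :
    ContDiff ℝ (⊤ : ℕ∞) (vprim f) := by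
  rw [show vprim f = _ from funext (vprim_eq f)]
  exact contDiff_param (g := fun y t => y 2 * f ![y 0, y 1, t * y 2]) (contDiff_vprim_integrand hf)

lemma pd_two_vprim {f : V3 → ℝ} (hf : ContDiff ℝ (⊤ : ℕ∞) f) (x : V3) :
    pd 2 (vprim f) x = f x := by
  have h1 := pd_eq_deriv (x := x) 2 ((contDiff_vprim hf).differentiable (by simp))
  have hc : Continuous fun s : ℝ => f ![x 0, x 1, s] :=
    hf.continuous.comp (contDiff_vec3 contDiff_const contDiff_const contDiff_id).continuous
  have h2 := (hc.integral_hasStrictDerivAt 0 (x 2 + 0)).hasDerivAt.comp (0:ℝ)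
    ((hasDerivAt_id (0:ℝ)).const_add (x 2))
  have h3 : (fun t : ℝ => vprim f (x + t • Pi.single 2 1)) =
      (fun u => ∫ s in (0:ℝ)..u, f ![x 0, x 1, s]) ∘ fun t => x 2 + id t := by
    ext t
    simp [vprim]
  rw [h3] at h1
  rw [h1.unique h2]
  have : ![x 0, x 1, x 2 + 0] = x := by ext i; fin_cases i <;> simp
  rw [this, mul_one]

lemma pd_vprim {f : V3 → ℝ} (hf : ContDiff ℝ (⊤ : ℕ∞) f) (x : V3) {j : Fin 3} (hj : j ≠ 2) :
    pd j (vprim f) x = vprim (pd j f) x := by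
  have hG := contDiff_vprim_integrand hf
  have h1 := hasFDerivAt_param (g := fun y t => y 2 * f ![y 0, y 1, t * y 2]) hG x
  rw [vprim_eq, pd, show vprim f = _ from funext (vprim_eq f), h1.fderiv,
    ContinuousLinearMap.intervalIntegral_apply]
  · congr 1
    ext t
    have hg : ContDiff ℝ (⊤ : ℕ∞) fun y : V3 => y 2 * f ![y 0, y 1, t * y 2] :=
      hG.comp (contDiff_id.prodMk contDiff_const)
    have h2 := pd_eq_deriv (x := x) j (hg.differentiable (by simp))
    have h3 := (pd_eq_deriv (x := ![x 0, x 1, t * x 2]) j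
      (hf.differentiable (by simp))).const_mul (x 2)
    refine h2.unique (h3.congr_of_eventuallyEq (Filter.Eventually.of_forall fun s => ?_))
    have hx2 : (x + s • (Pi.single j 1 : V3)) 2 = x 2 := by simp [hj.symm]
    have hv : ![(x + s • (Pi.single j 1 : V3)) 0, (x + s • (Pi.single j 1 : V3)) 1, t * x 2]
        = ![x 0, x 1, t * x 2] + s • (Pi.single j 1 : V3) := by
      ext i
      fin_cases i <;> simp [Pi.single_apply, hj.symm]
    simp only [hx2, hv]
  · have hd : ContDiff ℝ (⊤ : ℕ∞) (fun t : ℝ =>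
        fderiv ℝ (fun y : V3 => y 2 * f ![y 0, y 1, t * y 2]) x) := by
      refine ContDiff.fderiv (m := (⊤ : ℕ∞)) (n := (⊤ : ℕ∞))
        (f := fun (t : ℝ) (y : V3) => y 2 * f ![y 0, y 1, t * y 2]) ?_ contDiff_const (by simp)
      exact hG.comp (contDiff_snd.prodMk contDiff_fst)
    exact hd.continuous.intervalIntegrable _ _

lemma continuous_vertical {f : V3 → ℝ} (hf : Continuous f) (a b : ℝ) :
    Continuous fun s : ℝ => f ![a, b, s] :=
  hf.comp (contDiff_vec3 contDiff_const contDiff_const contDiff_id).continuous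

lemma vprim_pd_two {f : V3 → ℝ} (hf : ContDiff ℝ (⊤ : ℕ∞) f) (x : V3) :
    vprim (pd 2 f) x = f x - f ![x 0, x 1, 0] := by
  have h : ∀ s : ℝ, HasDerivAt (fun s => f ![x 0, x 1, s]) (pd 2 f ![x 0, x 1, s]) s := by
    intro s
    have h1 := pd_eq_deriv (x := ![x 0, x 1, s]) 2 (hf.differentiable (by simp))
    have h2 := HasDerivAt.comp s (h₂ := fun t : ℝ => f (![x 0, x 1, s] + t • Pi.single 2 1))
      (h := fun t => t - s) (by simpa using h1) ((hasDerivAt_id s).sub_const s)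
    rw [mul_one] at h2
    refine h2.congr_of_eventuallyEq (Filter.Eventually.of_forall fun t => ?_)
    simp only [Function.comp]
    congr 1
    ext i
    fin_cases i <;> simp
  rw [vprim, intervalIntegral.integral_eq_sub_of_hasDerivAt (fun s _ => h s)
    ((continuous_vertical (contDiff_pd 2 hf).continuous _ _).intervalIntegrable _ _)]
  congr 2
  ext i
  fin_cases i <;> simp

lemma abs_vprim_le {f : V3 → ℝ} {M : ℝ} (hM : ∀ x, |f x| ≤ M) {x : V3}
    (h0 : 0 ≤ x 2) (h1 : x 2 ≤ 1) : |vprim f x| ≤ M := by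
  have hM0 : 0 ≤ M := (abs_nonneg _).trans (hM 0)
  have h : ‖vprim f x‖ ≤ M * |x 2 - 0| :=
    intervalIntegral.norm_integral_le_of_norm_le_const fun s _ => hM _
  rw [Real.norm_eq_abs] at h
  refine h.trans ?_
  rw [sub_zero, abs_of_nonneg h0]
  nlinarith

lemma fderiv_eq_sum_pd (f : V3 → ℝ) (x v : V3) :
    fderiv ℝ f x v = v 0 * pd 0 f x + v 1 * pd 1 f x + v 2 * pd 2 f x := by
  have : v = v 0 • Pi.single 0 1 + v 1 • Pi.single 1 1 + v 2 • Pi.single 2 1 := by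
    ext i
    fin_cases i <;> simp
  conv_lhs => rw [this]
  simp [pd]

lemma hasDerivAt_cylPt_angle {f : V3 → ℝ} (hf : Differentiable ℝ f) (r θ z : ℝ) :
    HasDerivAt (fun t => f (cylPt r t z))
      (-(r * Real.sin θ) * pd 0 f (cylPt r θ z) + r * Real.cos θ * pd 1 f (cylPt r θ z)) θ := by
  have h : HasDerivAt (fun t => cylPt r t z) ![-(r * Real.sin θ), r * Real.cos θ, 0] θ := by
    rw [hasDerivAt_pi]
    intro i
    fin_cases i
    · simpa [cylPt] using (Real.hasDerivAt_cos θ).const_mul r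
    · simpa [cylPt] using (Real.hasDerivAt_sin θ).const_mul r
    · simpa [cylPt] using hasDerivAt_const θ z
  have h2 := (hf (cylPt r θ z)).hasFDerivAt.comp_hasDerivAt θ h
  rw [fderiv_eq_sum_pd] at h2
  simpa [Function.comp_def] using h2

lemma hasDerivAt_cylPt_radius {f : V3 → ℝ} (hf : Differentiable ℝ f) (r θ z : ℝ) :
    HasDerivAt (fun t => f (cylPt t θ z))
      (Real.cos θ * pd 0 f (cylPt r θ z) + Real.sin θ * pd 1 f (cylPt r θ z)) r := by
  have h : HasDerivAt (fun t => cylPt t θ z) ![Real.cos θ, Real.sin θ, 0] r := by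
    rw [hasDerivAt_pi]
    intro i
    fin_cases i
    · simpa [cylPt] using (hasDerivAt_id r).mul_const (Real.cos θ)
    · simpa [cylPt] using (hasDerivAt_id r).mul_const (Real.sin θ)
    · simpa [cylPt] using hasDerivAt_const r z
  have h2 := (hf (cylPt r θ z)).hasFDerivAt.comp_hasDerivAt r h
  rw [fderiv_eq_sum_pd] at h2
  simpa [Function.comp_def] using h2

lemma exists_cylPt (x : V3) : ∃ θ, x = cylPt (Real.sqrt (rho x)) θ (x 2) := by
  refine ⟨Complex.arg ⟨x 0, x 1⟩, ?_⟩
  have hn : Real.sqrt (rho x) = ‖(⟨x 0, x 1⟩ : ℂ)‖ := by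
    rw [Complex.norm_def, Complex.normSq_mk, rho]; ring_nf
  rw [hn]
  ext i
  fin_cases i <;> simp [cylPt, Complex.norm_mul_cos_arg, Complex.norm_mul_sin_arg]

/-- If `x'·V` is rotation invariant and the horizontal divergence of `V` is at most `q` at
height `z`, then the horizontal gradient of `x'·V` is at most `q |x'|` there: by Rolle's theorem
the angular derivative of the angular component of `V` vanishes somewhere on each circle. -/
lemma abs_pd_radial_le {P V0 V1 : V3 → ℝ} (hP : ∀ x, P x = x 0 * V0 x + x 1 * V1 x)
    (hV0 : ContDiff ℝ (⊤ : ℕ∞) V0) (hV1 : ContDiff ℝ (⊤ : ℕ∞) V1)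
    (hax : ∀ r θ z, P (cylPt r θ z) = P (cylPt r 0 z)) {q z : ℝ}
    (hq : ∀ x : V3, x 2 = z → |pd 0 V0 x + pd 1 V1 x| ≤ q) (x : V3) (hx : x 2 = z) :
    |pd 0 P x| ≤ q * Real.sqrt (rho x) ∧ |pd 1 P x| ≤ q * Real.sqrt (rho x) := by
  have dV0 := hV0.differentiable (by simp)
  have dV1 := hV1.differentiable (by simp)
  have hPe : P = fun x => x 0 * V0 x + x 1 * V1 x := funext hP
  have dP : Differentiable ℝ P := by rw [hPe]; fun_prop
  have pP : ∀ i y, pd i P y = y 0 * pd i V0 y + (if 0 = i then 1 else 0) * V0 y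
      + (y 1 * pd i V1 y + (if 1 = i then 1 else 0) * V1 y) := by
    intro i y
    rw [hPe, pd_add i (by fun_prop) (by fun_prop), pd_mul i (by fun_prop) (by fun_prop),
      pd_mul i (by fun_prop) (by fun_prop), pd_coord, pd_coord]
  have hq0 : 0 ≤ q := (abs_nonneg _).trans (hq x hx)
  have hind : ∀ r θ, Real.cos θ * pd 0 P (cylPt r θ z) + Real.sin θ * pd 1 P (cylPt r θ z)
      = pd 0 P (cylPt r 0 z) := by
    intro r θ
    have h1 := hasDerivAt_cylPt_radius dP r θ z
    have h2 := hasDerivAt_cylPt_radius dP r 0 z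
    simp only [hax _ θ] at h1
    simpa using h1.unique h2
  have hang : ∀ r θ, -(r * Real.sin θ) * pd 0 P (cylPt r θ z)
      + r * Real.cos θ * pd 1 P (cylPt r θ z) = 0 := by
    intro r θ
    have h1 := hasDerivAt_cylPt_angle dP r θ z
    simp only [hax r] at h1
    exact h1.unique (hasDerivAt_const θ _)
  obtain ⟨θ, hθ⟩ := exists_cylPt x
  set r := Real.sqrt (rho x) with hr
  have hr0 : 0 ≤ r := Real.sqrt_nonneg _
  rw [hx] at hθ
  rw [hθ]
  rcases hr0.eq_or_lt with h0 | hpos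
  · rw [← h0]
    have hc : ∀ θ, cylPt 0 θ z = cylPt 0 0 z := by intro θ; simp [cylPt]
    have h1 := hind 0 Real.pi
    have h2 := hind 0 (Real.pi / 2)
    rw [hc] at h1 h2
    simp only [Real.cos_pi, Real.sin_pi, Real.cos_pi_div_two, Real.sin_pi_div_two] at h1 h2
    have e0 : pd 0 P (cylPt 0 0 z) = 0 := by linarith
    have e1 : pd 1 P (cylPt 0 0 z) = 0 := by linarith
    rw [hc, e0, e1]
    simp
  · obtain ⟨φ, -, hφ⟩ := exists_hasDerivAt_eq_zero
      (f := fun t => (cylPt r t z) 0 * V1 (cylPt r t z) - (cylPt r t z) 1 * V0 (cylPt r t z))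
      Real.two_pi_pos
      (fun t _ => ContinuousAt.continuousWithinAt
        (hasDerivAt_cylPt_angle (f := fun y => y 0 * V1 y - y 1 * V0 y)
        (by fun_prop) r t z).continuousAt)
      (by simp [cylPt])
      (fun t _ => hasDerivAt_cylPt_angle (f := fun y => y 0 * V1 y - y 1 * V0 y)
        (by fun_prop) r t z)
    have pτ : ∀ i y, pd i (fun y => y 0 * V1 y - y 1 * V0 y) y
        = y 0 * pd i V1 y + (if 0 = i then 1 else 0) * V1 y
        - (y 1 * pd i V0 y + (if 1 = i then 1 else 0) * V0 y) := by
      intro i y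
      rw [pd_sub i (by fun_prop) (by fun_prop), pd_mul i (by fun_prop) (by fun_prop),
        pd_mul i (by fun_prop) (by fun_prop), pd_coord, pd_coord]
    have hD : pd 0 P (cylPt r 0 z)
        = r * (pd 0 V0 (cylPt r φ z) + pd 1 V1 (cylPt r φ z)) := by
      rw [← hind r φ]
      rw [pτ, pτ] at hφ
      rw [pP, pP]
      have hcs := Real.sin_sq_add_cos_sq φ
      have e0 : cylPt r φ z 0 = r * Real.cos φ := by simp [cylPt]
      have e1 : cylPt r φ z 1 = r * Real.sin φ := by simp [cylPt]
      rw [e0, e1] at hφ ⊢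
      simp only [if_true, one_ne_zero, zero_ne_one, if_false] at hφ ⊢
      apply mul_left_cancel₀ hpos.ne'
      linear_combination -hφ + r ^ 2 * (pd 0 V0 (cylPt r φ z) + pd 1 V1 (cylPt r φ z)) * hcs
    have hDb : |pd 0 P (cylPt r 0 z)| ≤ q * r := by
      rw [hD, abs_mul, abs_of_pos hpos, mul_comm]
      exact mul_le_mul_of_nonneg_right (hq _ (by simp [cylPt])) hr0
    have hi := hind r θ
    have ha : -Real.sin θ * pd 0 P (cylPt r θ z) + Real.cos θ * pd 1 P (cylPt r θ z) = 0 := by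
      apply mul_left_cancel₀ hpos.ne'
      linear_combination hang r θ
    have hcs := Real.sin_sq_add_cos_sq θ
    have e0 : pd 0 P (cylPt r θ z) = Real.cos θ * pd 0 P (cylPt r 0 z) := by
      rw [← hi]
      linear_combination -(pd 0 P (cylPt r θ z)) * hcs - Real.sin θ * ha
    have e1 : pd 1 P (cylPt r θ z) = Real.sin θ * pd 0 P (cylPt r 0 z) := by
      rw [← hi]
      linear_combination -(pd 1 P (cylPt r θ z)) * hcs + Real.cos θ * ha
    rw [e0, e1, abs_mul, abs_mul]
    have hc1 := Real.abs_cos_le_one θ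
    have hs1 := Real.abs_sin_le_one θ
    have hn := abs_nonneg (pd 0 P (cylPt r 0 z))
    constructor <;> nlinarith

/-- The stream function `∫₀^{x₃} r u^r ds` of the radial component. -/
def stream (u : V3 → V3) (x : V3) : ℝ :=
  x 0 * vprim (fun y => u y 0) x + x 1 * vprim (fun y => u y 1) x

section Stream

variable {u : V3 → V3}

lemma contDiff_stream (hu : ∀ i, ContDiff ℝ (⊤ : ℕ∞) (fun y => u y i)) :
    ContDiff ℝ (⊤ : ℕ∞) (stream u) := by
  have h0 := contDiff_vprim (hu 0)
  have h1 := contDiff_vprim (hu 1)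
  unfold stream
  fun_prop

lemma pd_two_stream (hu : ∀ i, ContDiff ℝ (⊤ : ℕ∞) (fun y => u y i)) (x : V3) :
    pd 2 (stream u) x = x 0 * u x 0 + x 1 * u x 1 := by
  have h0 := (contDiff_vprim (hu 0)).differentiable (by simp)
  have h1 := (contDiff_vprim (hu 1)).differentiable (by simp)
  rw [show stream u = fun x => x 0 * vprim (fun y => u y 0) x + x 1 * vprim (fun y => u y 1) x
    from rfl, pd_add 2 (by fun_prop) (by fun_prop), pd_mul 2 (by fun_prop) (by fun_prop),
    pd_mul 2 (by fun_prop) (by fun_prop), pd_coord, pd_coord, pd_two_vprim (hu 0),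
    pd_two_vprim (hu 1)]
  simp

lemma stream_cylPt (hu : ∀ i, ContDiff ℝ (⊤ : ℕ∞) (fun y => u y i))
    (hax : AxiSym (compR u)) (r θ z : ℝ) :
    stream u (cylPt r θ z) = stream u (cylPt r 0 z) := by
  have key : ∀ θ, stream u (cylPt r θ z) = r * ∫ s in (0:ℝ)..z, compR u r θ s := by
    intro θ
    have c0 := (continuous_vertical (hu 0).continuous (r * Real.cos θ) (r * Real.sin θ))
    have c1 := (continuous_vertical (hu 1).continuous (r * Real.cos θ) (r * Real.sin θ))
    simp only [compR, cylPt]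
    rw [intervalIntegral.integral_add ((c0.const_mul _).intervalIntegrable _ _)
      ((c1.const_mul _).intervalIntegrable _ _), intervalIntegral.integral_const_mul,
      intervalIntegral.integral_const_mul]
    simp [stream, vprim]
    ring
  rw [key, key]
  simp only [hax r θ 0]

lemma div_vprim (hu : ∀ i, ContDiff ℝ (⊤ : ℕ∞) (fun y => u y i)) (hdiv : DivFree u) (x : V3) :
    pd 0 (vprim fun y => u y 0) x + pd 1 (vprim fun y => u y 1) x
      = u ![x 0, x 1, 0] 2 - u x 2 := by
  rw [pd_vprim (hu 0) x (by decide), pd_vprim (hu 1) x (by decide)]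
  have h2 := vprim_pd_two (hu 2) x
  have c : ∀ i, IntervalIntegrable (fun s => pd i (fun y => u y i) ![x 0, x 1, s]) volume 0 (x 2) :=
    fun i => (continuous_vertical (contDiff_pd i (hu i)).continuous _ _).intervalIntegrable _ _
  have hsum : vprim (pd 0 fun y => u y 0) x + vprim (pd 1 fun y => u y 1) x
      + vprim (pd 2 fun y => u y 2) x = 0 := by
    simp only [vprim]
    rw [← intervalIntegral.integral_add (c 0) (c 1),
      ← intervalIntegral.integral_add ((c 0).add (c 1)) (c 2)]
    have : ∀ y, pd 0 (fun y => u y 0) y + pd 1 (fun y => u y 1) y + pd 2 (fun y => u y 2) y = 0 :=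
      fun y => by simpa [Fin.sum_univ_three] using hdiv y
    simp [this]
  linarith

lemma abs_pd_stream_le (hu : ∀ i, ContDiff ℝ (⊤ : ℕ∞) (fun y => u y i)) (hdiv : DivFree u)
    (hax : AxiSym (compR u)) {M : ℝ}
    (hM : ∀ x i, |u x i| ≤ M) (x : V3) (i : Fin 3) :
    |pd i (stream u) x| ≤ 2 * M * Real.sqrt (rho x) := by
  have h := abs_pd_radial_le (P := stream u) (q := 2 * M) (z := x 2) (fun _ => rfl)
    (contDiff_vprim (hu 0)) (contDiff_vprim (hu 1)) (stream_cylPt hu hax)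
    (fun y _ => by
      rw [div_vprim hu hdiv]
      refine (abs_sub _ _).trans ?_
      linarith [hM ![y 0, y 1, 0] 2, hM y 2]) x rfl
  fin_cases i
  · exact h.1
  · exact h.2
  · change |pd 2 (stream u) x| ≤ _
    rw [pd_two_stream hu]
    have e0 : |x 0| ≤ Real.sqrt (rho x) := Real.abs_le_sqrt (by simp [rho, sq_nonneg])
    have e1 : |x 1| ≤ Real.sqrt (rho x) := Real.abs_le_sqrt (by simp [rho, sq_nonneg])
    refine (abs_add_le _ _).trans ?_
    rw [abs_mul, abs_mul]
    have := mul_le_mul e0 (hM x 0) (abs_nonneg _) (Real.sqrt_nonneg _)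
    have := mul_le_mul e1 (hM x 1) (abs_nonneg _) (Real.sqrt_nonneg _)
    linarith

lemma abs_stream_le {M : ℝ} (hM : ∀ x i, |u x i| ≤ M) {x : V3} (h0 : 0 ≤ x 2) (h1 : x 2 ≤ 1) :
    |stream u x| ≤ 2 * M * Real.sqrt (rho x) := by
  have e0 : |x 0| ≤ Real.sqrt (rho x) := Real.abs_le_sqrt (by simp [rho, sq_nonneg])
  have e1 : |x 1| ≤ Real.sqrt (rho x) := Real.abs_le_sqrt (by simp [rho, sq_nonneg])
  refine (abs_add_le _ _).trans ?_
  rw [abs_mul, abs_mul]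
  have := mul_le_mul e0 (abs_vprim_le (fun y => hM y 0) h0 h1) (abs_nonneg _) (Real.sqrt_nonneg _)
  have := mul_le_mul e1 (abs_vprim_le (fun y => hM y 1) h0 h1) (abs_nonneg _) (Real.sqrt_nonneg _)
  linarith

lemma stream_zero {x : V3} (hx : x 2 = 0) : stream u x = 0 := by
  simp [stream, vprim, hx]

lemma stream_one (hu : ∀ i, ContDiff ℝ (⊤ : ℕ∞) (fun y => u y i)) (hdiv : DivFree u)
    (hax : AxiSym (compR u)) (hper : PeriodicZ u) {x : V3}
    (hx : x 2 = 1) : stream u x = 0 := by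
  have h : ∀ y : V3, y 2 = 1 →
      |pd 0 (vprim fun y => u y 0) y + pd 1 (vprim fun y => u y 1) y| ≤ 0 := by
    intro y hy
    rw [div_vprim hu hdiv]
    have h1 := hper ![y 0, y 1, 0]
    have h2 : y = ![y 0, y 1, 1] := by ext i; fin_cases i <;> simp [hy]
    simp only [Matrix.cons_val_zero, Matrix.cons_val_one, Matrix.cons_val, zero_add] at h1
    rw [← h2] at h1
    rw [h1]
    simp
  have hb := abs_pd_radial_le (P := stream u) (q := 0) (z := 1) (fun _ => rfl)
    (contDiff_vprim (hu 0)) (contDiff_vprim (hu 1)) (stream_cylPt hu hax) h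
  obtain ⟨θ, hθ⟩ := exists_cylPt x
  rw [hx] at hθ
  have hd : ∀ t, HasDerivAt (fun r => stream u (cylPt r θ 1)) 0 t := by
    intro t
    have h1 := hasDerivAt_cylPt_radius ((contDiff_stream hu).differentiable (by simp)) t θ 1
    have h2 := hb (cylPt t θ 1) (by simp [cylPt])
    simp only [zero_mul, abs_nonpos_iff] at h2
    simpa [h2.1, h2.2] using h1
  have hc := is_const_of_deriv_eq_zero (fun t => (hd t).differentiableAt) (fun t => (hd t).deriv)
    (Real.sqrt (rho x)) 0
  rw [hθ]
  exact hc.trans (by simp [stream, cylPt])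

end Stream

/-- The shell `{a ≤ |x'|² ≤ b} × [0,1]`. -/
def shell (a b : ℝ) : Set V3 := {x | x ∈ slab ∧ a ≤ rho x ∧ rho x ≤ b}

lemma continuous_rho : Continuous rho := contDiff_rho.continuous

lemma rho_nonneg (x : V3) : 0 ≤ rho x := by unfold rho; positivity

lemma isClosed_slab : IsClosed slab :=
  (isClosed_le continuous_const (continuous_apply 2)).inter
    (isClosed_le (continuous_apply 2) continuous_const)

lemma isClosed_shell (a b : ℝ) : IsClosed (shell a b) :=
  isClosed_slab.inter ((isClosed_le continuous_const continuous_rho).inter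
    (isClosed_le continuous_rho continuous_const))

lemma abs_le_of_rho_le {x : V3} {L : ℝ} (h : rho x ≤ L) :
    |x 0| ≤ |L| + 1 ∧ |x 1| ≤ |L| + 1 := by
  have h0 := le_abs_self L
  unfold rho at h
  constructor <;> refine abs_le_of_sq_le_sq ?_ (by positivity) <;>
    nlinarith [sq_nonneg (x 0), sq_nonneg (x 1), abs_nonneg L]

/-- A box containing `{|x'|² ≤ L} × [0,1]`. -/
def slabBox (L : ℝ) : Set V3 :=
  Set.Icc ![-(|L| + 1), -(|L| + 1), 0] ![|L| + 1, |L| + 1, 1]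

lemma mem_slabBox {x : V3} {L : ℝ} : x ∈ slabBox L ↔
    |x 0| ≤ |L| + 1 ∧ |x 1| ≤ |L| + 1 ∧ x ∈ slab := by
  simp only [slabBox, Set.mem_Icc, Pi.le_def, Fin.forall_fin_succ, slab, Set.mem_ofPred_eq, abs_le]
  simp
  tauto

lemma shell_subset_slabBox (a b : ℝ) : shell a b ⊆ slabBox b := fun _ hx =>
  mem_slabBox.2 ⟨(abs_le_of_rho_le hx.2.2).1, (abs_le_of_rho_le hx.2.2).2, hx.1⟩

lemma isCompact_shell (a b : ℝ) : IsCompact (shell a b) :=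
  isCompact_Icc.of_isClosed_subset (isClosed_shell a b) (shell_subset_slabBox a b)

lemma integrableOn_slab {f : V3 → ℝ} (hf : Continuous f) {L : ℝ}
    (hL : ∀ x, L < rho x → f x = 0) : IntegrableOn f slab := by
  have h : IntegrableOn f (shell 0 L) := hf.continuousOn.integrableOn_compact (isCompact_shell 0 L)
  refine h.of_forall_sdiff_eq_zero isClosed_slab.measurableSet fun x hx => hL x ?_
  by_contra! hc
  exact hx.2 ⟨hx.1, rho_nonneg x, hc⟩

lemma setIntegral_slab_eq_slabBox {f : V3 → ℝ} {L : ℝ} (hL : ∀ x, L < rho x → f x = 0) :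
    ∫ x in slab, f x = ∫ x in slabBox L, f x := by
  refine setIntegral_eq_of_subset_of_forall_sdiff_eq_zero isClosed_slab.measurableSet
    (fun x hx => (mem_slabBox.1 hx).2.2) fun x hx => hL x ?_
  by_contra! hc
  exact hx.2 (mem_slabBox.2 ⟨(abs_le_of_rho_le hc).1, (abs_le_of_rho_le hc).2, hx.1⟩)

lemma pd_eq_zero_of_rho_lt {f : V3 → ℝ} {L : ℝ} (hL : ∀ x, L < rho x → f x = 0) (i : Fin 3)
    {x : V3} (hx : L < rho x) : pd i f x = 0 := by
  have h : f =ᶠ[nhds x] fun _ => 0 := by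
    filter_upwards [(isOpen_lt continuous_const continuous_rho).mem_nhds hx] with y hy
    exact hL y hy
  rw [pd, h.fderiv_eq]
  simp

/-- Divergence theorem on the slab for horizontally compactly supported fields. -/
lemma integral_div_slab {F : Fin 3 → V3 → ℝ} (hF : ∀ i, ContDiff ℝ (⊤ : ℕ∞) (F i)) {L : ℝ}
    (hL : ∀ i x, L < rho x → F i x = 0) (hper : ∀ a b, F 2 ![a, b, 1] = F 2 ![a, b, 0]) :
    ∫ x in slab, ∑ i, pd i (F i) x = 0 := by
  have hL' : ∀ x, L < rho x → ∑ i, pd i (F i) x = 0 := fun x hx =>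
    Finset.sum_eq_zero fun i _ => pd_eq_zero_of_rho_lt (hL i) i hx
  rw [setIntegral_slab_eq_slabBox hL']
  have hle : (![-(|L| + 1), -(|L| + 1), 0] : V3) ≤ ![|L| + 1, |L| + 1, 1] := by
    intro i
    have := abs_nonneg L
    fin_cases i <;> simp <;> linarith
  have hc : Continuous fun x => ∑ i, pd i (F i) x :=
    continuous_finsetSum _ fun i _ => (contDiff_pd i (hF i)).continuous
  have hdiv := integral_divergence_of_hasFDerivAt_off_countable'
    (![-(|L| + 1), -(|L| + 1), 0] : V3) ![|L| + 1, |L| + 1, 1] hle F (fun i => fderiv ℝ (F i)) ∅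
    Set.countable_empty (fun i => (hF i).continuous.continuousOn)
    (fun x _ i => ((hF i).differentiable (by simp) x).hasFDerivAt)
    (hc.continuousOn.integrableOn_compact isCompact_Icc)
  have hside : ∀ (i : Fin 3) (x : V3), i ≠ 2 → |x i| = |L| + 1 → F i x = 0 := by
    intro i x hi hx
    refine hL i x ?_
    have h1 := le_abs_self L
    have h2 := sq_abs (x i)
    rw [hx] at h2
    unfold rho
    fin_cases i
    · simp at h2; nlinarith [sq_nonneg (x 1), abs_nonneg L]
    · simp at h2; nlinarith [sq_nonneg (x 0), abs_nonneg L]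
    · exact absurd rfl hi
  have hpos : 0 ≤ |L| + 1 := by positivity
  have hface : ∀ i : Fin 3, i ≠ 2 → |(![-(|L| + 1), -(|L| + 1), 0] : V3) i| = |L| + 1 ∧
      |(![|L| + 1, |L| + 1, 1] : V3) i| = |L| + 1 := by
    intro i hi
    have h1 : |(-(|L| + 1))| = |L| + 1 := by rw [abs_neg, abs_of_nonneg hpos]
    have h2 : |(|L| + 1)| = |L| + 1 := abs_of_nonneg hpos
    fin_cases i
    exacts [⟨h1, h2⟩, ⟨h1, h2⟩, absurd rfl hi]
  refine hdiv.trans (Finset.sum_eq_zero fun i _ => ?_)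
  rw [sub_eq_zero]
  congr 1
  ext y
  by_cases hi : i = 2
  · subst hi
    have e : ∀ t : ℝ, Fin.insertNth (α := fun _ => ℝ) (2 : Fin 3) t y = ![y 0, y 1, t] := by
      intro t
      ext j
      fin_cases j
      · exact Fin.insertNth_apply_succAbove (α := fun _ => ℝ) (2 : Fin 3) t y 0
      · exact Fin.insertNth_apply_succAbove (α := fun _ => ℝ) (2 : Fin 3) t y 1
      · exact Fin.insertNth_apply_same (α := fun _ => ℝ) (2 : Fin 3) t y
    rw [e, e]
    exact hper _ _
  · rw [hside i _ hi, hside i _ hi]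
    · rw [Fin.insertNth_apply_same]
      exact (hface i hi).1
    · rw [Fin.insertNth_apply_same]
      exact (hface i hi).2

section Volume

/-- Volume of the unit cylinder. -/
def unitVol : ℝ := volume.real (shell 0 1)

lemma volume_shell_zero {s : ℝ} (hs : 0 < s) : volume.real (shell 0 s) = s * unitVol := by
  let A : V3 →ₗ[ℝ] V3 := Matrix.toLin' (Matrix.diagonal ![Real.sqrt s, Real.sqrt s, 1])
  have hdet : LinearMap.det A = s := by
    simp only [A, LinearMap.det_toLin', Matrix.det_diagonal, Fin.prod_univ_three]
    simp [Real.mul_self_sqrt hs.le]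
  have hA : ∀ x, A x = ![Real.sqrt s * x 0, Real.sqrt s * x 1, x 2] := by
    intro x
    ext i
    simp only [A, Matrix.toLin'_apply, Matrix.mulVec_diagonal]
    fin_cases i <;> simp
  have hpre : A ⁻¹' shell 0 s = shell 0 1 := by
    ext x
    have : rho (A x) = s * rho x := by
      rw [hA]
      simp only [rho, Matrix.cons_val_zero, Matrix.cons_val_one, mul_pow, Real.sq_sqrt hs.le]
      ring
    simp only [Set.mem_preimage, shell, Set.mem_ofPred_eq, this, rho_nonneg, true_and]
    rw [mul_le_iff_le_one_right hs]
    simp [slab, hA]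
  have h := Measure.addHaar_preimage_linearMap volume (f := A) (by rw [hdet]; exact hs.ne')
    (shell 0 s)
  rw [hpre, hdet] at h
  rw [unitVol, Measure.real, Measure.real, h, ENNReal.toReal_mul,
    ENNReal.toReal_ofReal (abs_nonneg _),
    abs_of_pos (inv_pos.2 hs), mul_inv_cancel_left₀ hs.ne']

lemma volume_shell_ne_top (a b : ℝ) : volume (shell a b) ≠ ⊤ := (isCompact_shell a b).measure_ne_top

lemma unitVol_pos : 0 < unitVol := by
  have hU : IsOpen {x : V3 | (0 < x 2 ∧ x 2 < 1) ∧ rho x < 1} :=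
    ((isOpen_lt continuous_const (continuous_apply 2)).inter
      (isOpen_lt (continuous_apply 2) continuous_const)).inter
      (isOpen_lt continuous_rho continuous_const)
  have hne : {x : V3 | (0 < x 2 ∧ x 2 < 1) ∧ rho x < 1}.Nonempty :=
    ⟨![0, 0, 1 / 2], by
      simp only [rho, Set.mem_ofPred_eq, Matrix.cons_val]; norm_num⟩
  have hpos := (hU.measure_pos volume hne).trans_le
    (measure_mono (t := shell 0 1) fun x hx => ⟨⟨hx.1.1.le, hx.1.2.le⟩, rho_nonneg x, hx.2.le⟩)
  exact ENNReal.toReal_pos hpos.ne' (volume_shell_ne_top 0 1)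

lemma volume_shell_le {a b : ℝ} (hab : a ≤ b) (hb : 0 < b) :
    volume.real (shell a b) ≤ (b - a) * unitVol := by
  have hv := unitVol_pos
  rcases le_or_gt a 0 with ha | ha
  · calc volume.real (shell a b) ≤ volume.real (shell 0 b) :=
          measureReal_mono (fun x hx => ⟨hx.1, rho_nonneg x, hx.2.2⟩) (volume_shell_ne_top 0 b)
      _ = b * unitVol := volume_shell_zero hb
      _ ≤ _ := by gcongr; linarith
  · have key : ∀ s, 0 < s → s < a → volume.real (shell a b) ≤ (b - s) * unitVol := by
      intro s hs hsa
      have hdisj : Disjoint (shell 0 s) (shell a b) :=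
        Set.disjoint_left.2 fun x hx hy => by linarith [hx.2.2, hy.2.1]
      have hunion :
          volume.real (shell 0 s) + volume.real (shell a b) ≤ volume.real (shell 0 b) := by
        rw [← measureReal_union hdisj (isClosed_shell a b).measurableSet
          (volume_shell_ne_top _ _) (volume_shell_ne_top _ _)]
        refine measureReal_mono (Set.union_subset ?_ ?_) (volume_shell_ne_top 0 b)
        · exact fun x hx => ⟨hx.1, hx.2.1, hx.2.2.trans (by linarith)⟩
        · exact fun x hx => ⟨hx.1, rho_nonneg x, hx.2.2⟩
      rw [volume_shell_zero hs, volume_shell_zero hb] at hunion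
      linarith
    refine le_of_forall_pos_le_add fun ε hε => ?_
    have h1 : 0 < min (ε / unitVol) (a / 2) := by positivity
    have h2 := key (a - min (ε / unitVol) (a / 2))
      (by linarith [min_le_right (ε / unitVol) (a / 2)]) (by linarith)
    have h3 : min (ε / unitVol) (a / 2) * unitVol ≤ ε :=
      (mul_le_mul_of_nonneg_right (min_le_left _ _) hv.le).trans (by field_simp; rfl)
    linarith

lemma volume_sphere {a : ℝ} (ha : 0 < a) : volume (shell a a) = 0 := by
  have h := volume_shell_le le_rfl ha
  rw [sub_self, zero_mul] at h
  have h2 := le_antisymm h measureReal_nonneg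
  exact (measureReal_eq_zero_iff (volume_shell_ne_top a a)).1 h2

end Volume

section Derivative

lemma nr_eq (x : V3) : nr x = Real.sqrt (rho x) := rfl

lemma continuous_nr : Continuous nr := continuous_rho.sqrt

lemma OR_eq_shell {R : ℝ} (hR : 1 ≤ R) : OR R = shell ((R - 1) ^ 2) (R ^ 2) := by
  ext x
  simp only [OR, shell, slab, Set.mem_ofPred_eq, nr_eq]
  rw [Real.le_sqrt (by linarith), Real.sqrt_le_left (by linarith)]
  exact rho_nonneg x

lemma volume_nr_eq {a : ℝ} (ha : 0 < a) : ∀ᵐ x ∂volume.restrict slab, nr x ≠ a := by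
  rw [ae_restrict_iff' isClosed_slab.measurableSet, ae_iff]
  refine measure_mono_null (fun x hx => ?_) (volume_sphere (pow_pos ha 2))
  simp only [Set.mem_ofPred_eq, Classical.not_imp, not_not] at hx
  have : rho x = a ^ 2 := by rw [← hx.2, nr_eq, Real.sq_sqrt (rho_nonneg x)]
  exact ⟨hx.1, this.ge, this.le⟩

lemma continuous_phiR (s : ℝ) : Continuous (phiR s) := by
  have := continuous_nr
  unfold phiR
  fun_prop

lemma abs_phiR_sub_le (s t : ℝ) (x : V3) : |phiR s x - phiR t x| ≤ |s - t| := by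
  unfold phiR
  refine (abs_min_sub_min_le_max _ _ _ _).trans ?_
  rw [sub_self, abs_zero, max_eq_right (abs_nonneg _)]
  refine (abs_max_sub_max_le_max _ _ _ _).trans ?_
  rw [sub_self, abs_zero, max_eq_right (abs_nonneg _)]
  simp

lemma phiR_eq_zero {s : ℝ} {x : V3} (h : s ≤ nr x) : phiR s x = 0 := by
  simp [phiR, sub_nonpos.2 h]

lemma phiR_eq_one {s : ℝ} {x : V3} (h : nr x ≤ s - 1) : phiR s x = 1 := by
  rw [phiR, max_eq_right (by linarith), min_eq_left (by linarith)]

lemma phiR_eq_sub {s : ℝ} {x : V3} (h1 : s - 1 ≤ nr x) (h2 : nr x ≤ s) : phiR s x = s - nr x := by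
  rw [phiR, max_eq_right (by linarith), min_eq_right (by linarith)]

/-- `Y'(R)` is the integral over the annular region `O_R`. -/
lemma hasDerivAt_integral_phiR {G : V3 → ℝ} (hG : Continuous G) {R : ℝ} (hR : 1 < R) :
    HasDerivAt (fun s => ∫ x in slab, G x * phiR s x) (∫ x in OR R, G x) R := by
  have hOR : MeasurableSet (OR R) := by
    rw [OR_eq_shell hR.le]; exact (isClosed_shell _ _).measurableSet
  have hS : MeasurableSet (shell 0 ((R + 1) ^ 2)) := (isClosed_shell _ _).measurableSet
  have hint : ∀ s, 0 ≤ s → IntegrableOn (fun x => G x * phiR s x) slab := fun s hs =>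
    integrableOn_slab (hG.mul (continuous_phiR s)) (L := s ^ 2) fun x hx => by
      rw [phiR_eq_zero (Real.le_sqrt_of_sq_le hx.le), mul_zero]
  have h := hasDerivAt_integral_of_dominated_loc_of_lip (μ := volume.restrict slab)
    (F := fun s x => G x * phiR s x) (F' := (OR R).indicator G) (x₀ := R)
    (bound := (shell 0 ((R + 1) ^ 2)).indicator fun x => |G x|) (Metric.ball_mem_nhds R one_pos)
    (Filter.Eventually.of_forall fun s => (hG.mul (continuous_phiR s)).aestronglyMeasurable)
    (hint R (by linarith)) (hG.stronglyMeasurable.indicator hOR).aestronglyMeasurable ?_ ?_ ?_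
  · have h2 := h.2
    rwa [integral_indicator hOR, Measure.restrict_restrict hOR,
      Set.inter_eq_left.2 fun x hx => hx.1] at h2
  · rw [ae_restrict_iff' isClosed_slab.measurableSet]
    refine Filter.Eventually.of_forall fun x hx =>
      LipschitzOnWith.of_dist_le_mul fun s hs t ht => ?_
    rw [Metric.mem_ball, Real.dist_eq, abs_lt] at hs ht
    rw [Real.dist_eq, Real.dist_eq, Real.coe_nnabs]
    by_cases hmem : x ∈ shell 0 ((R + 1) ^ 2)
    · rw [Set.indicator_of_mem hmem, abs_abs, ← mul_sub, abs_mul]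
      exact mul_le_mul_of_nonneg_left (abs_phiR_sub_le s t x) (abs_nonneg _)
    · have hlt : (R + 1) ^ 2 < rho x := by
        by_contra! hc
        exact hmem ⟨hx, rho_nonneg x, hc⟩
      have hnr : R + 1 ≤ nr x := Real.le_sqrt_of_sq_le hlt.le
      rw [phiR_eq_zero (by linarith), phiR_eq_zero (by linarith)]
      simp only [mul_zero, sub_self, abs_zero]
      positivity
  · have : IntegrableOn (fun x => |G x|) (shell 0 ((R + 1) ^ 2)) :=
      hG.abs.continuousOn.integrableOn_compact (isCompact_shell _ _)
    exact (this.integrable_indicator hS).restrict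
  · filter_upwards [volume_nr_eq (a := R) (by linarith), volume_nr_eq (a := R - 1) (by linarith),
      ae_restrict_mem isClosed_slab.measurableSet] with x h1 h2 hx
    rcases lt_or_gt_of_ne h1 with h1 | h1
    · rcases lt_or_gt_of_ne h2 with h2 | h2
      · have hn : x ∉ OR R := fun hm => by linarith [hm.2.1]
        rw [Set.indicator_of_notMem hn]
        refine (hasDerivAt_const R (G x)).congr_of_eventuallyEq ?_
        filter_upwards [lt_mem_nhds (show nr x + 1 < R by linarith)] with s hs
        rw [phiR_eq_one (by linarith), mul_one]
      · have hm : x ∈ OR R := ⟨hx, h2.le, h1.le⟩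
        rw [Set.indicator_of_mem hm]
        have hd := ((hasDerivAt_id R).sub_const (nr x)).const_mul (G x)
        rw [mul_one] at hd
        refine hd.congr_of_eventuallyEq ?_
        filter_upwards [lt_mem_nhds h1, gt_mem_nhds (show R < nr x + 1 by linarith)] with s hs hs'
        rw [phiR_eq_sub (by linarith) hs.le, id]
    · have hn : x ∉ OR R := fun hm => by linarith [hm.2.2]
      rw [Set.indicator_of_notMem hn]
      refine (hasDerivAt_const R (0:ℝ)).congr_of_eventuallyEq ?_
      filter_upwards [gt_mem_nhds h1] with s hs
      rw [phiR_eq_zero hs.le, mul_zero]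

end Derivative

@[fun_prop]
lemma differentiable_pd {f : V3 → ℝ} (i : Fin 3) (hf : ContDiff ℝ (⊤ : ℕ∞) f) :
    Differentiable ℝ (pd i f) := (contDiff_pd i hf).differentiable (by simp)

/-- The electric-type field `(∇×b)×b` of the Hall term. -/
def hallField (b : V3 → V3) (x : V3) : V3 := cross3 (curl b x) (b x)

lemma contDiff_hallField {b : V3 → V3} (hb : ContDiff ℝ (⊤ : ℕ∞) b) :
    ContDiff ℝ (⊤ : ℕ∞) (hallField b) := by
  rw [contDiff_pi]
  intro i
  fin_cases i <;> simp [hallField, cross3, curl] <;> fun_prop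

/-- The energy flux: minus the flux of kinetic and magnetic energy and of the pressure, plus the
diffusive and the Hall flux. Its divergence is the dissipation `|∇u|² + |∇b|²`. -/
def energyFlux (δ : ℝ) (u b : V3 → V3) (p : V3 → ℝ) (j : Fin 3) (y : V3) : ℝ :=
  (∑ i, (u y i * pd j (fun y => u y i) y + b y i * pd j (fun y => b y i) y))
    - u y j * ((dot3 (u y) (u y) + dot3 (b y) (b y)) / 2 + p y) + b y j * dot3 (u y) (b y)
    + δ * cross3 (hallField b y) (b y) j

lemma contDiff_energyFlux {δ : ℝ} {u b : V3 → V3} {p : V3 → ℝ} (hu : ContDiff ℝ (⊤ : ℕ∞) u)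
    (hb : ContDiff ℝ (⊤ : ℕ∞) b) (hp : ContDiff ℝ (⊤ : ℕ∞) p) (j : Fin 3) :
    ContDiff ℝ (⊤ : ℕ∞) (energyFlux δ u b p j) := by
  have hE := contDiff_hallField hb
  unfold energyFlux
  simp only [dot3, Fin.sum_univ_three]
  fin_cases j <;> simp [cross3] <;> fun_prop

set_option maxHeartbeats 4000000 in
lemma div_energyFlux {δ : ℝ} {u b : V3 → V3} {p : V3 → ℝ} (hu : ContDiff ℝ (⊤ : ℕ∞) u)
    (hb : ContDiff ℝ (⊤ : ℕ∞) b) (hp : ContDiff ℝ (⊤ : ℕ∞) p) (hsol : IsMHD δ u b p) (x : V3) :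
    ∑ j, pd j (energyFlux δ u b p j) x = gradSq u x + gradSq b x := by
  have hE := contDiff_hallField hb
  have du : Differentiable ℝ u := hu.differentiable (by simp)
  have db : Differentiable ℝ b := hb.differentiable (by simp)
  have dp : Differentiable ℝ p := hp.differentiable (by simp)
  have dE : Differentiable ℝ (hallField b) := hE.differentiable (by simp)
  obtain ⟨h1, h2, h3, h4⟩ := hsol
  have hort : dot3 (hallField b x) (curl b x) = 0 := by
    simp [dot3, hallField, cross3, Fin.sum_univ_three]
    ring
  have h1 := h1 x
  have h2 := h2 x
  have h3 := h3 x
  have h4 := h4 x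
  change ∀ i, _ = δ * curl (hallField b) x i at h2
  simp only [dot3, curl, Fin.sum_univ_three, Matrix.cons_val] at hort
  simp only [Fin.forall_fin_succ, lap, curl, Fin.sum_univ_three] at h1 h2 h3 h4
  simp at h1 h2
  obtain ⟨h10, h11, h12⟩ := h1
  obtain ⟨h20, h21, h22⟩ := h2
  unfold energyFlux
  simp only [Fin.sum_univ_three, dot3, cross3, gradSq, div_eq_mul_inv, Matrix.cons_val]
  simp (disch := fun_prop) only [pd_add, pd_sub, pd_mul, pd_const]
  linear_combination (-u x 0) * h10 - u x 1 * h11 - u x 2 * h12 - b x 0 * h20 - b x 1 * h21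
    - b x 2 * h22 - ((u x 0 ^ 2 + u x 1 ^ 2 + u x 2 ^ 2 + b x 0 ^ 2 + b x 1 ^ 2 + b x 2 ^ 2) / 2
    + p x) * h3 + (u x 0 * b x 0 + u x 1 * b x 1 + u x 2 * b x 2) * h4 - δ * hort

section Periodicity

/-- A function that is `1`-periodic in `x₃`. -/
def VertPeriodic (f : V3 → ℝ) : Prop := ∀ x, f (x + Pi.single 2 1) = f x

lemma PeriodicZ.vertPeriodic {u : V3 → V3} (hu : PeriodicZ u) (i : Fin 3) :
    VertPeriodic fun y => u y i := by
  intro x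
  have h : x + Pi.single 2 1 = ![x 0, x 1, x 2 + 1] := by
    ext i
    fin_cases i <;> simp
  simp only [h, hu x]

lemma pd_add_const (f : V3 → ℝ) (i : Fin 3) (x v : V3) :
    pd i (fun y => f (y + v)) x = pd i f (x + v) := by
  unfold pd
  rw [fderiv_comp_add_right]

lemma VertPeriodic.pd {f : V3 → ℝ} (hf : VertPeriodic f) (i : Fin 3) :
    VertPeriodic (pd i f) := by
  intro x
  rw [← pd_add_const, funext hf]

lemma VertPeriodic.top_eq_bottom {f : V3 → ℝ} (hf : VertPeriodic f) (s t : ℝ) :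
    f ![s, t, 1] = f ![s, t, 0] := by
  rw [← hf ![s, t, 0]]
  congr 1
  ext i
  fin_cases i <;> simp

lemma eq_zero_of_pd_eq_zero {g : V3 → ℝ} (hg : Differentiable ℝ g) (h : ∀ i x, pd i g x = 0)
    (x y : V3) : g x = g y :=
  is_const_of_fderiv_eq_zero hg (fun x => by
    ext v
    simp [fderiv_eq_sum_pd, h]) x y

end Periodicity

section Cutoff

/-- A radial cut-off varying on the scale of the annulus `O_R`. -/
def cutoff (S : ℝ → ℝ) (R ρ : ℝ) : ℝ := S ((ρ - R ^ 2) / (2 * R - 1))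

/-- The size of the first two derivatives of a radial cut-off, weighted by powers of the
radius. -/
def cutoffSize (h : ℝ → ℝ) (ρ : ℝ) : ℝ :=
  (1 + Real.sqrt ρ) * |deriv h ρ| + ρ * |deriv (deriv h) ρ|

lemma contDiff_cutoff {S : ℝ → ℝ} (hS : ContDiff ℝ (⊤ : ℕ∞) S) (R : ℝ) :
    ContDiff ℝ (⊤ : ℕ∞) (cutoff S R) := by
  unfold cutoff
  exact hS.comp (by fun_prop)

lemma contDiff_deriv_real {S : ℝ → ℝ} (hS : ContDiff ℝ (⊤ : ℕ∞) S) :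
    ContDiff ℝ (⊤ : ℕ∞) (deriv S) :=
  (contDiff_infty_iff_deriv.1 hS).2

lemma deriv_cutoff {S : ℝ → ℝ} (hS : Differentiable ℝ S) (R ρ : ℝ) :
    deriv (cutoff S R) ρ = cutoff (deriv S) R ρ / (2 * R - 1) := by
  have h1 : HasDerivAt (fun r : ℝ => (r - R ^ 2) / (2 * R - 1)) (1 / (2 * R - 1)) ρ :=
    ((hasDerivAt_id ρ).sub_const _).div_const _
  have h2 := (hS ((ρ - R ^ 2) / (2 * R - 1))).hasDerivAt.comp ρ h1
  rw [show cutoff S R = S ∘ fun r : ℝ => (r - R ^ 2) / (2 * R - 1) from rfl, h2.deriv]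
  simp [cutoff, div_eq_mul_inv]

lemma deriv_deriv_cutoff {S : ℝ → ℝ} (hS : ContDiff ℝ (⊤ : ℕ∞) S) (R ρ : ℝ) :
    deriv (deriv (cutoff S R)) ρ = cutoff (deriv (deriv S)) R ρ / (2 * R - 1) ^ 2 := by
  rw [funext (deriv_cutoff (hS.differentiable (by simp)) R), deriv_div_const,
    deriv_cutoff ((contDiff_deriv_real hS).differentiable (by simp))]
  rw [div_div, sq]

lemma cutoffSize_le {S W : ℝ → ℝ} (hS : ContDiff ℝ (⊤ : ℕ∞) S) (h1 : ∀ t, |deriv S t| ≤ W t)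
    (h2 : ∀ t, |deriv (deriv S) t| ≤ W t) (hW : ∀ t, 2 < t → W t = 0) {R ρ : ℝ} (hR : 2 ≤ R) :
    cutoffSize (cutoff S R) ρ ≤ 7 * cutoff W R ρ := by
  rw [cutoffSize, deriv_cutoff (hS.differentiable (by simp)), deriv_deriv_cutoff hS]
  have hd : 0 < 2 * R - 1 := by linarith
  rw [abs_div, abs_div, abs_of_pos hd, abs_of_pos (by positivity : 0 < (2 * R - 1) ^ 2)]
  unfold cutoff
  set t := (ρ - R ^ 2) / (2 * R - 1) with ht
  have h1 := h1 t
  have h2 := h2 t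
  rcases lt_or_ge 2 t with h | h
  · rw [hW t h] at *
    have e1 : |deriv S t| = 0 := le_antisymm h1 (abs_nonneg _)
    have e2 : |deriv (deriv S) t| = 0 := le_antisymm h2 (abs_nonneg _)
    simp [e1, e2]
  · have hW0 : 0 ≤ W t := (abs_nonneg _).trans h1
    rw [ht, div_le_iff₀ hd] at h
    have h3 : ρ ≤ (2 * (2 * R - 1)) ^ 2 := by nlinarith
    have h4 : Real.sqrt ρ ≤ 2 * (2 * R - 1) := by
      rw [← Real.sqrt_sq (by positivity : 0 ≤ 2 * (2 * R - 1))]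
      exact Real.sqrt_le_sqrt h3
    have h5 : (1 + Real.sqrt ρ) * (|deriv S t| / (2 * R - 1)) ≤ 3 * W t := by
      rw [← mul_div_assoc, div_le_iff₀ hd]
      calc _ ≤ (3 * (2 * R - 1)) * W t := by gcongr; linarith
        _ = _ := by ring
    have h6 : ρ * (|deriv (deriv S) t| / (2 * R - 1) ^ 2) ≤ 4 * W t := by
      rw [← mul_div_assoc, div_le_iff₀ (by positivity)]
      calc _ ≤ (2 * (2 * R - 1)) ^ 2 * W t := by gcongr
        _ = _ := by ring
    linarith

lemma cutoff_eq_zero {S : ℝ → ℝ} {a : ℝ} (hS : ∀ t, a < t → S t = 0) {R ρ : ℝ} (hR : 2 ≤ R)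
    (hρ : R ^ 2 + a * (2 * R - 1) < ρ) : cutoff S R ρ = 0 :=
  hS _ ((lt_div_iff₀ (by linarith)).2 (by linarith))

/-- The profile of the inner cut-off: `1` on `(-∞, -1]` and `0` on `[0, ∞)`. -/
def innerProfile (t : ℝ) : ℝ := Real.smoothTransition (-t)

lemma contDiff_innerProfile : ContDiff ℝ (⊤ : ℕ∞) innerProfile :=
  Real.smoothTransition.contDiff.comp contDiff_neg

lemma innerProfile_eq_zero {t : ℝ} (ht : 0 ≤ t) : innerProfile t = 0 :=
  Real.smoothTransition.zero_of_nonpos (by linarith)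

lemma innerProfile_eq_one {t : ℝ} (ht : t ≤ -1) : innerProfile t = 1 :=
  Real.smoothTransition.one_of_one_le (by linarith)

lemma innerProfile_nonneg (t : ℝ) : 0 ≤ innerProfile t := Real.smoothTransition.nonneg _

lemma deriv_eq_zero_of_const_on {f : ℝ → ℝ} {s : Set ℝ} (hs : IsOpen s) {c : ℝ}
    (h : ∀ t ∈ s, f t = c) : ∀ t ∈ s, deriv f t = 0 := by
  intro t ht
  have h1 : f =ᶠ[nhds t] fun _ => c := by
    filter_upwards [hs.mem_nhds ht] with y hy using h y hy
  rw [h1.deriv_eq, deriv_const]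

lemma exists_bound_derivs {S : ℝ → ℝ} (hS : ContDiff ℝ (⊤ : ℕ∞) S) {a b : ℝ} :
    ∃ B > 0, ∀ t ∈ Set.Icc a b, |deriv S t| ≤ B ∧ |deriv (deriv S) t| ≤ B := by
  have c1 := contDiff_deriv_real hS
  have c2 := contDiff_deriv_real c1
  obtain ⟨B1, h1⟩ := (isCompact_Icc (a := a) (b := b)).exists_bound_of_continuousOn
    c1.continuous.continuousOn
  obtain ⟨B2, h2⟩ := (isCompact_Icc (a := a) (b := b)).exists_bound_of_continuousOn
    c2.continuous.continuousOn
  refine ⟨max (max B1 B2) 1, by positivity, fun t ht => ⟨?_, ?_⟩⟩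
  · exact (h1 t ht).trans ((le_max_left _ _).trans (le_max_left _ _))
  · exact (h2 t ht).trans ((le_max_right _ _).trans (le_max_left _ _))

lemma exists_bound_innerProfile : ∃ B > 0, ∀ t,
    |deriv innerProfile t| ≤ (Set.Icc (-1) 0).indicator (fun _ => B) t ∧
    |deriv (deriv innerProfile) t| ≤ (Set.Icc (-1) 0).indicator (fun _ => B) t := by
  obtain ⟨B, hB, h⟩ := exists_bound_derivs contDiff_innerProfile (a := -1) (b := 0)
  refine ⟨B, hB, fun t => ?_⟩
  by_cases ht : t ∈ Set.Icc (-1 : ℝ) 0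
  · simpa [Set.indicator_of_mem ht] using h t ht
  · have e1 : ∀ t ∈ (Set.Icc (-1 : ℝ) 0)ᶜ, deriv innerProfile t = 0 := by
      intro t ht
      rw [Set.mem_compl_iff, Set.mem_Icc, not_and_or, not_le, not_le] at ht
      rcases ht with ht | ht
      · exact deriv_eq_zero_of_const_on isOpen_Iio (c := 1)
          (fun s hs => innerProfile_eq_one (le_of_lt hs)) t ht
      · exact deriv_eq_zero_of_const_on isOpen_Ioi (c := 0)
          (fun s hs => innerProfile_eq_zero (le_of_lt hs)) t ht
    have e2 := deriv_eq_zero_of_const_on isClosed_Icc.isOpen_compl e1 t ht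
    simp [Set.indicator_of_notMem ht, e1 t ht, e2]

/-- A constant controlling the derivatives of the inner cut-offs. -/
lemma exists_cutoffSize_inner : ∃ B > 0, ∀ R ≥ (2:ℝ), ∀ x ∈ slab,
    cutoffSize (cutoff innerProfile R) (rho x) ≤ (OR R).indicator (fun _ => B) x := by
  obtain ⟨B, hB, h⟩ := exists_bound_innerProfile
  refine ⟨7 * B, by positivity, fun R hR x hx => ?_⟩
  refine (cutoffSize_le contDiff_innerProfile (fun t => (h t).1) (fun t => (h t).2)
    (fun t ht => Set.indicator_of_notMem (fun h' => by linarith [h'.2]) _) hR).trans ?_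
  have hd : 0 < 2 * R - 1 := by linarith
  by_cases hxR : x ∈ OR R
  · rw [Set.indicator_of_mem hxR]
    gcongr
    exact Set.indicator_le_self' (fun _ _ => hB.le) _
  · rw [Set.indicator_of_notMem hxR, cutoff, Set.indicator_of_notMem, mul_zero]
    rintro ⟨h1, h2⟩
    rw [le_div_iff₀ hd] at h1
    rw [div_le_iff₀ hd] at h2
    refine hxR ?_
    rw [OR_eq_shell (by linarith)]
    exact ⟨hx, by nlinarith, by linarith⟩

end Cutoff

section Radial

/-- `η` is a radial cut-off with gradient `k (x₁, x₂, 0)`, and `k` has gradient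
`m (x₁, x₂, 0)`. -/
structure IsRadial (η k m : V3 → ℝ) : Prop where
  contDiff : ContDiff ℝ (⊤ : ℕ∞) η
  contDiff_snd : ContDiff ℝ (⊤ : ℕ∞) k
  pd_zero (x : V3) : pd 0 η x = k x * x 0
  pd_one (x : V3) : pd 1 η x = k x * x 1
  pd_two (x : V3) : pd 2 η x = 0
  pd_zero_snd (x : V3) : pd 0 k x = m x * x 0
  pd_one_snd (x : V3) : pd 1 k x = m x * x 1
  pd_two_snd (x : V3) : pd 2 k x = 0

lemma isRadial_comp_rho {h : ℝ → ℝ} (hh : ContDiff ℝ (⊤ : ℕ∞) h) :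
    IsRadial (fun x => h (rho x)) (fun x => 2 * deriv h (rho x))
      (fun x => 4 * deriv (deriv h) (rho x)) := by
  have h1 := contDiff_deriv_real hh
  have d0 : Differentiable ℝ h := hh.differentiable (by simp)
  have d1 : Differentiable ℝ (deriv h) := h1.differentiable (by simp)
  have dr : Differentiable ℝ rho := contDiff_rho.differentiable (by simp)
  have e : ∀ i x, pd i (fun x => 2 * deriv h (rho x)) x
      = 2 * (deriv (deriv h) (rho x) * pd i rho x) := by
    intro i x
    rw [pd_mul i (by fun_prop) (by fun_prop), pd_comp i d1 dr, pd_const]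
    ring
  refine ⟨hh.comp contDiff_rho, contDiff_const.mul (h1.comp contDiff_rho), ?_, ?_, ?_, ?_, ?_, ?_⟩
    <;> intro x <;> simp only [e, pd_comp _ d0 dr, pd_rho, Matrix.cons_val] <;> ring

lemma abs_coord_le_sqrt_rho (x : V3) :
    |x 0| ≤ Real.sqrt (rho x) ∧ |x 1| ≤ Real.sqrt (rho x) := by
  constructor <;> refine Real.abs_le_sqrt ?_ <;> unfold rho <;>
    nlinarith [sq_nonneg (x 0), sq_nonneg (x 1)]

lemma abs_radial_component_le {v : V3} {M : ℝ} (hv : ∀ i, |v i| ≤ M) (x : V3) :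
    |x 0 * v 0 + x 1 * v 1| ≤ 2 * M * Real.sqrt (rho x) := by
  obtain ⟨h0, h1⟩ := abs_coord_le_sqrt_rho x
  calc _ ≤ |x 0| * |v 0| + |x 1| * |v 1| := by
        rw [← abs_mul, ← abs_mul]; exact abs_add_le _ _
    _ ≤ Real.sqrt (rho x) * M + Real.sqrt (rho x) * M := by
        gcongr <;> exact hv _
    _ = _ := by ring

end Radial

section Pressure

variable {δ : ℝ} {u b : V3 → V3} {p : V3 → ℝ}

lemma exists_pressure_jump (hp : ContDiff ℝ (⊤ : ℕ∞) p) (hup : PeriodicZ u) (hbp : PeriodicZ b)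
    (hsol : IsMHD δ u b p) : ∃ c, ∀ x, p (x + Pi.single 2 1) = p x + c := by
  have pu := hup.vertPeriodic
  have pb := hbp.vertPeriodic
  have dp : Differentiable ℝ p := hp.differentiable (by simp)
  have ds : Differentiable ℝ fun y => p (y + (Pi.single 2 1 : V3)) := by fun_prop
  have pp : ∀ i x, pd i p (x + Pi.single 2 1) = pd i p x := by
    intro i x
    have h1 := hsol.1 x i
    have h2 := hsol.1 (x + Pi.single 2 1) i
    have e1 := fun i j => (pu i).pd j x
    have e2 := fun i j => (pb i).pd j x
    have e3 := fun i j => ((pu i).pd j).pd j x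
    have e4 := fun i => pu i x
    have e5 := fun i => pb i x
    simp only [lap, e1, e2, e3] at h1 h2
    simp only [e4, e5] at h2
    linarith
  have h := eq_zero_of_pd_eq_zero (g := fun y => p (y + Pi.single 2 1) - p y) (ds.sub dp)
    (fun i x => by rw [pd_sub i ds dp, pd_add_const, pp, sub_self])
  refine ⟨p (0 + Pi.single 2 1) - p 0, fun x => ?_⟩
  have := h x 0
  linarith

/-- The vertical momentum flux, localized by a radial cut-off and corrected so as to be
vertically periodic. -/
def momentumFlux (u b : V3 → V3) (p η k : V3 → ℝ) (c : ℝ) : Fin 3 → V3 → ℝ :=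
  ![fun y => η y * (pd 0 (fun y => u y 2) y - u y 0 * u y 2 + b y 0 * b y 2)
      - u y 2 * (k y * y 0),
    fun y => η y * (pd 1 (fun y => u y 2) y - u y 1 * u y 2 + b y 1 * b y 2)
      - u y 2 * (k y * y 1),
    fun y => η y * (pd 2 (fun y => u y 2) y - u y 2 * u y 2 + b y 2 * b y 2 - (p y - c * y 2))]

lemma div_momentumFlux (hu : ContDiff ℝ (⊤ : ℕ∞) u) (hb : ContDiff ℝ (⊤ : ℕ∞) b)
    (hp : ContDiff ℝ (⊤ : ℕ∞) p) (hsol : IsMHD δ u b p) {η k m : V3 → ℝ} (hη : IsRadial η k m)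
    (c : ℝ) (x : V3) :
    ∑ i, pd i (momentumFlux u b p η k c i) x = c * η x
      - (u x 2 * (2 * k x + m x * rho x) + k x * (x 0 * u x 0 + x 1 * u x 1) * u x 2
        - k x * (x 0 * b x 0 + x 1 * b x 1) * b x 2) := by
  have du : Differentiable ℝ u := hu.differentiable (by simp)
  have db : Differentiable ℝ b := hb.differentiable (by simp)
  have dp : Differentiable ℝ p := hp.differentiable (by simp)
  have dη : Differentiable ℝ η := hη.contDiff.differentiable (by simp)
  have dk : Differentiable ℝ k := hη.contDiff_snd.differentiable (by simp)
  obtain ⟨h1, -, h3, h4⟩ := hsol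
  have h1 := h1 x 2
  have h3 := h3 x
  have h4 := h4 x
  simp only [lap, Fin.sum_univ_three] at h1 h3 h4
  simp only [momentumFlux, Fin.sum_univ_three, Matrix.cons_val]
  simp (disch := fun_prop) only [pd_add, pd_sub, pd_mul, pd_const, pd_coord, hη.pd_zero, hη.pd_one,
    hη.pd_two, hη.pd_zero_snd, hη.pd_one_snd]
  simp only [if_true, rho]
  linear_combination (-η x) * h1 - η x * u x 2 * h3 + η x * b x 2 * h4

lemma momentumFlux_eq_zero {η k : V3 → ℝ} {c L : ℝ} (h0 : ∀ x, L < rho x → η x = 0)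
    (h1 : ∀ x, L < rho x → k x = 0) (i : Fin 3) (x : V3) (hx : L < rho x) :
    momentumFlux u b p η k c i x = 0 := by
  fin_cases i <;> simp [momentumFlux, h0 x hx, h1 x hx]

lemma abs_momentum_remainder_le {M : ℝ} (hM : ∀ x i, |u x i| ≤ M) (hM' : ∀ x i, |b x i| ≤ M)
    (h : ℝ → ℝ) (x : V3) :
    |u x 2 * (2 * (2 * deriv h (rho x)) + 4 * deriv (deriv h) (rho x) * rho x)
        + 2 * deriv h (rho x) * (x 0 * u x 0 + x 1 * u x 1) * u x 2
        - 2 * deriv h (rho x) * (x 0 * b x 0 + x 1 * b x 1) * b x 2|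
      ≤ (4 * M + 8 * M ^ 2) * cutoffSize h (rho x) := by
  have hM0 : 0 ≤ M := (abs_nonneg _).trans (hM x 0)
  have hρ := rho_nonneg x
  set d := deriv h (rho x)
  set d2 := deriv (deriv h) (rho x)
  have eu := abs_radial_component_le (hM x) x
  have eb := abs_radial_component_le (hM' x) x
  set s := Real.sqrt (rho x)
  have hs : 0 ≤ s := Real.sqrt_nonneg _
  have a1 : |u x 2 * (2 * (2 * d) + 4 * d2 * rho x)| ≤ M * (4 * |d| + 4 * (rho x * |d2|)) := by
    rw [abs_mul]
    gcongr
    · exact hM x 2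
    · refine (abs_add_le _ _).trans (le_of_eq ?_)
      simp only [abs_mul, abs_of_nonneg hρ, abs_two, abs_of_pos (by norm_num : (0:ℝ) < 4)]
      ring
  have a2 : |2 * d * (x 0 * u x 0 + x 1 * u x 1) * u x 2| ≤ 2 * |d| * (2 * M * s) * M := by
    simp only [abs_mul, abs_two]
    gcongr
    exact hM x 2
  have a3 : |2 * d * (x 0 * b x 0 + x 1 * b x 1) * b x 2| ≤ 2 * |d| * (2 * M * s) * M := by
    simp only [abs_mul, abs_two]
    gcongr
    exact hM' x 2
  have a4 := abs_sub (u x 2 * (2 * (2 * d) + 4 * d2 * rho x)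
    + 2 * d * (x 0 * u x 0 + x 1 * u x 1) * u x 2) (2 * d * (x 0 * b x 0 + x 1 * b x 1) * b x 2)
  have a5 := abs_add_le (u x 2 * (2 * (2 * d) + 4 * d2 * rho x))
    (2 * d * (x 0 * u x 0 + x 1 * u x 1) * u x 2)
  have p1 : 0 ≤ M * (s * |d|) := by positivity
  have p2 : 0 ≤ M ^ 2 * |d| := by positivity
  have p3 : 0 ≤ M ^ 2 * (rho x * |d2|) := by positivity
  unfold cutoffSize
  nlinarith

lemma measurableSet_shell (s t : ℝ) : MeasurableSet (shell s t) :=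
  (isClosed_shell s t).measurableSet

lemma integral_indicator_shell (s t B : ℝ) :
    ∫ x in slab, (shell s t).indicator (fun _ => B) x = B * volume.real (shell s t) := by
  rw [setIntegral_indicator (measurableSet_shell s t),
    Set.inter_eq_right.2 (fun x hx => hx.1 : shell s t ⊆ slab), setIntegral_const, smul_eq_mul,
    mul_comm]

lemma integrableOn_indicator_shell {f : V3 → ℝ} (hf : Continuous f) (s t : ℝ) :
    IntegrableOn ((shell s t).indicator f) slab :=
  ((hf.continuousOn.integrableOn_compact (isCompact_shell s t)).integrable_indicator
    (measurableSet_shell s t)).integrableOn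

lemma volume_OR_le {R : ℝ} (hR : 2 ≤ R) : volume.real (OR R) ≤ 2 * R * unitVol := by
  rw [OR_eq_shell (by linarith)]
  refine (volume_shell_le (by nlinarith) (by positivity)).trans ?_
  gcongr
  · exact unitVol_pos.le
  · nlinarith

/-- A cut-off profile vanishing beyond `L` has vanishing derivatives beyond `L`. -/
lemma deriv_eq_zero_beyond {h : ℝ → ℝ} {L : ℝ} (hL : ∀ ρ, L < ρ → h ρ = 0) :
    ∀ ρ, L < ρ → deriv h ρ = 0 :=
  deriv_eq_zero_of_const_on isOpen_Ioi hL

lemma cutoff_innerProfile_eq_zero {R ρ : ℝ} (hR : 2 ≤ R) (hρ : R ^ 2 < ρ) :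
    cutoff innerProfile R ρ = 0 :=
  innerProfile_eq_zero (div_nonneg (by linarith) (by linarith))

lemma cutoff_innerProfile_eq_one {R ρ : ℝ} (hR : 2 ≤ R) (hρ : ρ ≤ (R - 1) ^ 2) :
    cutoff innerProfile R ρ = 1 :=
  innerProfile_eq_one ((div_le_iff₀ (by linarith)).2 (by nlinarith))

lemma volume_le_integral_inner {R : ℝ} (hR : 2 ≤ R) :
    (R - 1) ^ 2 * unitVol ≤ ∫ x in slab, cutoff innerProfile R (rho x) := by
  have hc : Continuous fun x => cutoff innerProfile R (rho x) :=
    (contDiff_cutoff contDiff_innerProfile R).continuous.comp continuous_rho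
  rw [← volume_shell_zero (by nlinarith : (0:ℝ) < (R - 1) ^ 2), ← one_mul (volume.real _),
    ← integral_indicator_shell]
  refine integral_mono (integrableOn_indicator_shell continuous_const _ _)
    (integrableOn_slab hc fun x hx => cutoff_innerProfile_eq_zero hR hx) fun x => ?_
  by_cases hx : x ∈ shell 0 ((R - 1) ^ 2)
  · simp only [Set.indicator_of_mem hx]
    rw [cutoff_innerProfile_eq_one hR hx.2.2]
  · rw [Set.indicator_of_notMem hx]
    exact innerProfile_nonneg _

lemma vertPeriodic_pressure {δ : ℝ} {u b : V3 → V3} {p : V3 → ℝ} (hu : ContDiff ℝ (⊤ : ℕ∞) u)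
    (hb : ContDiff ℝ (⊤ : ℕ∞) b) (hp : ContDiff ℝ (⊤ : ℕ∞) p) (hup : PeriodicZ u)
    (hbp : PeriodicZ b) (hsol : IsMHD δ u b p) {M : ℝ} (hM : ∀ x i, |u x i| ≤ M)
    (hM' : ∀ x i, |b x i| ≤ M) : VertPeriodic p := by
  obtain ⟨c, hc⟩ := exists_pressure_jump hp hup hbp hsol
  obtain ⟨B, hB, hcut⟩ := exists_cutoffSize_inner
  have hM0 : 0 ≤ M := (abs_nonneg _).trans (hM 0 0)
  set K := 4 * M + 8 * M ^ 2 with hK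
  have key : ∀ R ≥ (2:ℝ), |c| * (R - 1) ^ 2 ≤ K * B * (2 * R) := by
    intro R hR
    set h := cutoff innerProfile R with hh
    have hsm : ContDiff ℝ (⊤ : ℕ∞) h := contDiff_cutoff contDiff_innerProfile R
    have hrad := isRadial_comp_rho hsm
    have z0 : ∀ ρ, R ^ 2 < ρ → h ρ = 0 := fun ρ => cutoff_innerProfile_eq_zero hR
    have z1 := deriv_eq_zero_beyond z0
    have z2 := deriv_eq_zero_beyond z1
    have c1 := (contDiff_deriv_real hsm).continuous
    have c2 := (contDiff_deriv_real (contDiff_deriv_real hsm)).continuous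
    have cr := continuous_rho
    have cu := hu.continuous
    have cb := hb.continuous
    have hF : ∀ i, ContDiff ℝ (⊤ : ℕ∞) (momentumFlux u b p (fun x => h (rho x))
        (fun x => 2 * deriv h (rho x)) c i) := by
      have := hrad.contDiff
      have := hrad.contDiff_snd
      intro i
      fin_cases i <;> simp only [momentumFlux, Fin.zero_eta, Fin.mk_one, Fin.reduceFinMk,
        Matrix.cons_val] <;> fun_prop
    have hint := integral_div_slab hF (L := R ^ 2)
      (momentumFlux_eq_zero (fun x hx => z0 _ hx) (fun x hx => by rw [z1 _ hx, mul_zero]))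
      (fun s t => by
        have e1 := fun i => (hup.vertPeriodic i).top_eq_bottom s t
        have e2 := fun i => (hbp.vertPeriodic i).top_eq_bottom s t
        have e3 := ((hup.vertPeriodic 2).pd 2).top_eq_bottom s t
        have e4 : p ![s, t, 1] = p ![s, t, 0] + c := by
          rw [← hc]
          congr 1
          ext i
          fin_cases i <;> simp
        simp [momentumFlux, e1, e2, e3, e4, rho])
    simp only [div_momentumFlux hu hb hp hsol hrad] at hint
    rw [integral_sub, integral_const_mul] at hint
    · have hη := volume_le_integral_inner hR
      have hpos := unitVol_pos
      have hle : |c| * ((R - 1) ^ 2 * unitVol) ≤ K * B * volume.real (OR R) := by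
        calc |c| * ((R - 1) ^ 2 * unitVol) ≤ |c| * ∫ x in slab, h (rho x) := by gcongr
          _ = |c * ∫ x in slab, h (rho x)| := by
              rw [abs_mul, abs_of_nonneg (le_trans (by positivity) hη)]
          _ ≤ ∫ x in slab, (OR R).indicator (fun _ => K * B) x := by
              rw [sub_eq_zero.1 hint, ← Real.norm_eq_abs]
              rw [OR_eq_shell (by linarith)]
              refine norm_integral_le_of_norm_le
                (integrableOn_indicator_shell continuous_const _ _) ?_
              refine (ae_restrict_iff' isClosed_slab.measurableSet).2 (.of_forall fun x hx => ?_)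
              rw [Real.norm_eq_abs]
              refine (abs_momentum_remainder_le hM hM' h x).trans ?_
              rw [← OR_eq_shell (by linarith)]
              refine (mul_le_mul_of_nonneg_left (hcut R hR x hx) (by positivity)).trans
                (le_of_eq ?_)
              exact (Set.indicator_const_mul _ _ _ _).symm
          _ = K * B * volume.real (OR R) := by
              rw [OR_eq_shell (by linarith), integral_indicator_shell]
      have := mul_le_mul_of_nonneg_left (volume_OR_le hR) (by positivity : 0 ≤ K * B)
      refine le_of_mul_le_mul_right (a := unitVol) ?_ hpos
      linarith
    · exact integrableOn_slab (L := R ^ 2) (by fun_prop) fun x hx => by simp [z0 _ hx]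
    · exact integrableOn_slab (L := R ^ 2) (by fun_prop) fun x hx => by simp [z1 _ hx, z2 _ hx]
  have hc0 : c = 0 := by
    by_contra hne
    have hpos : 0 < |c| := abs_pos.2 hne
    have hK0 : 0 ≤ K * B := by positivity
    set t := 4 * (K * B) / |c| + 1 with ht
    have ht1 : 1 ≤ t := by
      rw [ht]; linarith [div_nonneg (by positivity : 0 ≤ 4 * (K * B)) hpos.le]
    have h1 := key (t + 1) (by linarith)
    have h2 : |c| * t = 4 * (K * B) + |c| := by rw [ht]; field_simp
    have h3 : |c| * (t + 1 - 1) ^ 2 = (4 * (K * B) + |c|) * t := by rw [← h2]; ring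
    rw [h3] at h1
    nlinarith
  intro x
  rw [hc, hc0, add_zero]

section LocalEnergy

variable {δ : ℝ} {u b : V3 → V3} {p : V3 → ℝ}

/-- The energy flux localized by a radial cut-off `η` with gradient `k (x₁, x₂, 0)`. The terms
containing the stream functions replace the radial transport of energy and pressure, which is
not controlled by the gradients of `u` and `b`, by terms that are. -/
def localFlux (δ : ℝ) (u b : V3 → V3) (p η k : V3 → ℝ) : Fin 3 → V3 → ℝ :=
  ![fun y => η y * energyFlux δ u b p 0 y - k y * stream u y * pd 0 (fun y => u y 2) y,
    fun y => η y * energyFlux δ u b p 1 y - k y * stream u y * pd 1 (fun y => u y 2) y,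
    fun y => η y * energyFlux δ u b p 2 y - k y * stream u y * pd 2 (fun y => u y 2) y
      + k y * (stream u y * ((dot3 (u y) (u y) + dot3 (b y) (b y)) / 2 + p y)
        - stream b y * dot3 (u y) (b y))]

/-- The derivative of `(|u|² + |b|²) / 2` in the direction `j`. -/
def energyDeriv (u b : V3 → V3) (j : Fin 3) (x : V3) : ℝ :=
  dot3 (u x) (fun i => pd j (fun y => u y i) x) + dot3 (b x) (fun i => pd j (fun y => b y i) x)

/-- The terms of the localized energy identity in which derivatives fall on the cut-off. -/
def energyRemainder (δ : ℝ) (u b : V3 → V3) (k m : V3 → ℝ) (x : V3) : ℝ :=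
  k x * (x 0 * (energyDeriv u b 0 x + δ * cross3 (hallField b x) (b x) 0)
      + x 1 * (energyDeriv u b 1 x + δ * cross3 (hallField b x) (b x) 1)
      + (stream u x * (energyDeriv u b 2 x - dot3 (u x) (fun j => pd j (fun y => u y 2) x)
          + dot3 (b x) (fun j => pd j (fun y => b y 2) x))
        - stream b x * (dot3 (u x) (fun i => pd 2 (fun y => b y i) x)
          + dot3 (b x) (fun i => pd 2 (fun y => u y i) x))
        - dot3 (fun j => pd j (stream u) x) (fun j => pd j (fun y => u y 2) x)))
    - m x * (stream u x * (x 0 * pd 0 (fun y => u y 2) x + x 1 * pd 1 (fun y => u y 2) x))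

lemma contDiff_localFlux (hu : ContDiff ℝ (⊤ : ℕ∞) u) (hb : ContDiff ℝ (⊤ : ℕ∞) b)
    (hp : ContDiff ℝ (⊤ : ℕ∞) p) {η k m : V3 → ℝ} (hη : IsRadial η k m) (i : Fin 3) :
    ContDiff ℝ (⊤ : ℕ∞) (localFlux δ u b p η k i) := by
  have h1 := contDiff_energyFlux (δ := δ) hu hb hp
  have h2 := hη.contDiff
  have h3 := hη.contDiff_snd
  have h4 : ContDiff ℝ (⊤ : ℕ∞) (stream u) := contDiff_stream fun i => by fun_prop
  have h5 : ContDiff ℝ (⊤ : ℕ∞) (stream b) := contDiff_stream fun i => by fun_prop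
  have := h1 0
  have := h1 1
  have := h1 2
  fin_cases i <;> simp only [localFlux, dot3, Fin.sum_univ_three, Fin.zero_eta, Fin.mk_one,
    Fin.reduceFinMk, Matrix.cons_val] <;> fun_prop

set_option maxHeartbeats 1000000 in
lemma div_localFlux (hu : ContDiff ℝ (⊤ : ℕ∞) u) (hb : ContDiff ℝ (⊤ : ℕ∞) b)
    (hp : ContDiff ℝ (⊤ : ℕ∞) p) (hsol : IsMHD δ u b p) {η k m : V3 → ℝ} (hη : IsRadial η k m)
    (x : V3) :
    ∑ i, pd i (localFlux δ u b p η k i) x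
      = (gradSq u x + gradSq b x) * η x + energyRemainder δ u b k m x := by
  have du : Differentiable ℝ u := hu.differentiable (by simp)
  have db : Differentiable ℝ b := hb.differentiable (by simp)
  have dp : Differentiable ℝ p := hp.differentiable (by simp)
  have dη : Differentiable ℝ η := hη.contDiff.differentiable (by simp)
  have dk : Differentiable ℝ k := hη.contDiff_snd.differentiable (by simp)
  have su : Differentiable ℝ (stream u) :=
    (contDiff_stream fun i => by fun_prop).differentiable (by simp)
  have sb : Differentiable ℝ (stream b) :=
    (contDiff_stream fun i => by fun_prop).differentiable (by simp)
  have e2u := pd_two_stream (u := u) (fun i => by fun_prop) x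
  have e2b := pd_two_stream (u := b) (fun i => by fun_prop) x
  have dF := fun j => (contDiff_energyFlux (δ := δ) hu hb hp j).differentiable (by simp)
  have hdiv := div_energyFlux hu hb hp hsol x
  have dF0 := dF 0
  have dF1 := dF 1
  have dF2 := dF 2
  have f0 : energyFlux δ u b p 0 x = energyDeriv u b 0 x
      - u x 0 * ((dot3 (u x) (u x) + dot3 (b x) (b x)) / 2 + p x) + b x 0 * dot3 (u x) (b x)
      + δ * cross3 (hallField b x) (b x) 0 := by
    simp [energyFlux, energyDeriv, dot3, Fin.sum_univ_three]; ring
  have f1 : energyFlux δ u b p 1 x = energyDeriv u b 1 x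
      - u x 1 * ((dot3 (u x) (u x) + dot3 (b x) (b x)) / 2 + p x) + b x 1 * dot3 (u x) (b x)
      + δ * cross3 (hallField b x) (b x) 1 := by
    simp [energyFlux, energyDeriv, dot3, Fin.sum_univ_three]; ring
  have h1 := hsol.1 x 2
  simp only [lap, Fin.sum_univ_three] at h1 hdiv
  simp only [localFlux, energyRemainder, Fin.sum_univ_three, Matrix.cons_val]
  simp only [dot3, energyDeriv, Fin.sum_univ_three, div_eq_mul_inv] at f0 f1 ⊢
  simp (disch := fun_prop) only [pd_add, pd_sub, pd_mul, pd_const, hη.pd_zero, hη.pd_one,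
    hη.pd_two, hη.pd_zero_snd, hη.pd_one_snd, hη.pd_two_snd]
  rw [f0, f1, e2u, e2b]
  linear_combination η x * hdiv + k x * stream u x * h1

end LocalEnergy

section Estimate

lemma abs_dot3_le {v w : V3} {s t : ℝ} (hv : ∀ i, |v i| ≤ s) (hw : ∀ i, |w i| ≤ t) :
    |dot3 v w| ≤ 3 * s * t := by
  have hs : 0 ≤ s := (abs_nonneg _).trans (hv 0)
  refine (Finset.abs_sum_le_sum_abs _ _).trans ?_
  calc ∑ i, |v i * w i| ≤ ∑ _i : Fin 3, s * t := by
        gcongr with i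
        rw [abs_mul]
        gcongr
        · exact hv i
        · exact hw i
    _ = 3 * s * t := by simp; ring

lemma abs_mul_add_mul_le {x₀ x₁ y₀ y₁ s t : ℝ} (h0 : |x₀| ≤ s) (h1 : |x₁| ≤ s) (k0 : |y₀| ≤ t)
    (k1 : |y₁| ≤ t) : |x₀ * y₀ + x₁ * y₁| ≤ 2 * s * t := by
  have hs : 0 ≤ s := (abs_nonneg _).trans h0
  calc _ ≤ |x₀| * |y₀| + |x₁| * |y₁| := by
        rw [← abs_mul, ← abs_mul]; exact abs_add_le _ _
    _ ≤ s * t + s * t := by gcongr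
    _ = _ := by ring

lemma abs_cross3_le {v w : V3} {s t : ℝ} (hv : ∀ i, |v i| ≤ s) (hw : ∀ i, |w i| ≤ t) (i : Fin 3) :
    |cross3 v w i| ≤ 2 * s * t := by
  have h := fun i j i' j' => abs_mul_add_mul_le (hv i) (hv i') (hw j)
    (by rw [abs_neg]; exact hw j' : |-w j'| ≤ t)
  fin_cases i <;> simp only [cross3, Fin.zero_eta, Fin.mk_one, Fin.reduceFinMk, Matrix.cons_val,
    sub_eq_add_neg, ← mul_neg] <;> exact h _ _ _ _

lemma gradSq_nonneg (u : V3 → V3) (x : V3) : 0 ≤ gradSq u x := by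
  unfold gradSq; positivity

lemma sq_pd_le_gradSq (u : V3 → V3) (x : V3) (i j : Fin 3) :
    pd i (fun y => u y j) x ^ 2 ≤ gradSq u x :=
  (Finset.single_le_sum (f := fun j => pd i (fun y => u y j) x ^ 2)
    (fun _ _ => sq_nonneg _) (Finset.mem_univ j)).trans
  (Finset.single_le_sum (f := fun i => ∑ j, pd i (fun y => u y j) x ^ 2)
    (fun _ _ => by positivity) (Finset.mem_univ i))

lemma continuous_gradSq {u : V3 → V3} (hu : ContDiff ℝ (⊤ : ℕ∞) u) : Continuous (gradSq u) := by
  have := fun i j => (contDiff_pd i (by fun_prop : ContDiff ℝ (⊤ : ℕ∞) fun y => u y j)).continuous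
  unfold gradSq
  fun_prop

variable {δ : ℝ} {u b : V3 → V3} {p : V3 → ℝ}

lemma abs_energyRemainder_le (hδ : δ ∈ Set.Icc (0:ℝ) 1) (hu : ContDiff ℝ (⊤ : ℕ∞) u)
    (hsol : IsMHD δ u b p) (haxu : AxiSym (compR u)) {M : ℝ} (hM : ∀ x i, |u x i| ≤ M)
    (hM' : ∀ x i, |b x i| ≤ M) (h : ℝ → ℝ) {x : V3} (hx : x ∈ slab) :
    |energyRemainder δ u b (fun x => 2 * deriv h (rho x))
        (fun x => 4 * deriv (deriv h) (rho x)) x|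
      ≤ (36 * M + 104 * M ^ 2)
        * (Real.sqrt (gradSq u x + gradSq b x) * cutoffSize h (rho x)) := by
  have hM0 : 0 ≤ M := (abs_nonneg _).trans (hM x 0)
  have hρ := rho_nonneg x
  have gu : ∀ i j, |pd i (fun y => u y j) x| ≤ Real.sqrt (gradSq u x + gradSq b x) :=
    fun i j => Real.abs_le_sqrt (by linarith [sq_pd_le_gradSq u x i j, gradSq_nonneg b x])
  have gb : ∀ i j, |pd i (fun y => b y j) x| ≤ Real.sqrt (gradSq u x + gradSq b x) :=
    fun i j => Real.abs_le_sqrt (by linarith [sq_pd_le_gradSq b x i j, gradSq_nonneg u x])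
  have hs0 : 0 ≤ Real.sqrt (rho x) := Real.sqrt_nonneg _
  have hss : Real.sqrt (rho x) * Real.sqrt (rho x) = rho x := Real.mul_self_sqrt hρ
  have hg0 : 0 ≤ Real.sqrt (gradSq u x + gradSq b x) := Real.sqrt_nonneg _
  obtain ⟨hx0, hx1⟩ := abs_coord_le_sqrt_rho x
  have hSu := abs_stream_le hM hx.1 hx.2
  have hSb := abs_stream_le hM' hx.1 hx.2
  have hdS := abs_pd_stream_le (fun i => by fun_prop) hsol.2.2.1 haxu hM x
  set g := Real.sqrt (gradSq u x + gradSq b x)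
  set s := Real.sqrt (rho x)
  have hE : ∀ j, |energyDeriv u b j x| ≤ 6 * M * g := fun j =>
    (abs_add_le _ _).trans (by
      linarith [abs_dot3_le (hM x) (gu j), abs_dot3_le (hM' x) (gb j)])
  have hcurl : ∀ j, |curl b x j| ≤ 2 * g := by
    have aux : ∀ i j i' j', |pd i (fun y => b y j) x - pd i' (fun y => b y j') x| ≤ 2 * g :=
      fun i j i' j' => (abs_sub _ _).trans (by linarith [gb i j, gb i' j'])
    intro j
    fin_cases j <;> exact aux _ _ _ _
  have hH : ∀ j, |δ * cross3 (hallField b x) (b x) j| ≤ 8 * M ^ 2 * g := fun j => by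
    have := abs_cross3_le (abs_cross3_le hcurl (hM' x)) (hM' x) j
    rw [abs_mul, abs_of_nonneg hδ.1]
    calc _ ≤ 1 * (2 * (2 * (2 * g) * M) * M) := by
          gcongr
          · exact hδ.2
          · exact this
      _ = _ := by ring
  have hA : ∀ j, |energyDeriv u b j x + δ * cross3 (hallField b x) (b x) j|
      ≤ 6 * M * g + 8 * M ^ 2 * g := fun j =>
    (abs_add_le _ _).trans (add_le_add (hE j) (hH j))
  have t1 := abs_mul_add_mul_le hx0 hx1 (hA 0) (hA 1)
  have t2 : |stream u x * (energyDeriv u b 2 x - dot3 (u x) (fun j => pd j (fun y => u y 2) x)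
      + dot3 (b x) (fun j => pd j (fun y => b y 2) x))| ≤ 2 * M * s * (12 * M * g) := by
    rw [abs_mul]
    gcongr
    refine (abs_add_le _ _).trans ((add_le_add_left (abs_sub _ _) _).trans ?_)
    linarith [hE 2, abs_dot3_le (hM x) (fun j => gu j 2), abs_dot3_le (hM' x) (fun j => gb j 2)]
  have t3 : |stream b x * (dot3 (u x) (fun i => pd 2 (fun y => b y i) x)
      + dot3 (b x) (fun i => pd 2 (fun y => u y i) x))| ≤ 2 * M * s * (6 * M * g) := by
    rw [abs_mul]
    gcongr
    refine (abs_add_le _ _).trans ?_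
    linarith [abs_dot3_le (hM x) (gb 2), abs_dot3_le (hM' x) (gu 2)]
  have t4 := abs_dot3_le hdS (fun j => gu j 2)
  have t5 : |stream u x * (x 0 * pd 0 (fun y => u y 2) x + x 1 * pd 1 (fun y => u y 2) x)|
      ≤ 2 * M * s * (2 * s * g) := by
    rw [abs_mul]
    gcongr
    exact abs_mul_add_mul_le hx0 hx1 (gu 0 2) (gu 1 2)
  unfold energyRemainder
  refine (abs_sub _ _).trans ?_
  rw [abs_mul, abs_mul (4 * _)]
  simp only [abs_mul (2:ℝ), abs_mul (4:ℝ), abs_two, abs_of_pos (by norm_num : (0:ℝ) < 4)]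
  set d := |deriv h (rho x)|
  set d2 := |deriv (deriv h) (rho x)|
  have hd : 0 ≤ d := abs_nonneg _
  have hd2 : 0 ≤ d2 := abs_nonneg _
  calc _ ≤ 2 * d * (2 * s * (6 * M * g + 8 * M ^ 2 * g) + (2 * M * s * (12 * M * g)
            + 2 * M * s * (6 * M * g) + 3 * (2 * M * s) * g))
          + 4 * d2 * (2 * M * s * (2 * s * g)) := by
        gcongr
        refine (abs_add_le _ _).trans (add_le_add t1 ((abs_sub _ _).trans (add_le_add
          ((abs_sub _ _).trans (add_le_add t2 t3)) t4)))
    _ = (36 * M + 104 * M ^ 2) * (g * (s * d)) + 16 * M * (g * (rho x * d2)) := by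
        rw [← hss]; ring
    _ ≤ (36 * M + 104 * M ^ 2) * (g * (s * d)) + (36 * M + 104 * M ^ 2) * (g * (rho x * d2))
          + (36 * M + 104 * M ^ 2) * (g * d) := by
        have : 16 * M ≤ 36 * M + 104 * M ^ 2 := by nlinarith
        have h1 : 16 * M * (g * (rho x * d2)) ≤ (36 * M + 104 * M ^ 2) * (g * (rho x * d2)) := by
          gcongr
        have h2 : 0 ≤ (36 * M + 104 * M ^ 2) * (g * d) := by positivity
        linarith
    _ = _ := by unfold cutoffSize; ring

lemma localFlux_eq_zero {η k : V3 → ℝ} {L : ℝ} (h0 : ∀ x, L < rho x → η x = 0)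
    (h1 : ∀ x, L < rho x → k x = 0) (i : Fin 3) (x : V3) (hx : L < rho x) :
    localFlux δ u b p η k i x = 0 := by
  fin_cases i <;> simp [localFlux, h0 x hx, h1 x hx]

lemma localFlux_top_eq_bottom (hu : ContDiff ℝ (⊤ : ℕ∞) u) (hb : ContDiff ℝ (⊤ : ℕ∞) b)
    (hup : PeriodicZ u) (hbp : PeriodicZ b) (hpp : VertPeriodic p) (hsol : IsMHD δ u b p)
    (haxu : AxiSym (compR u)) (haxb : AxiSym (compR b)) (f k : ℝ → ℝ) (s t : ℝ) :
    localFlux δ u b p (fun x => f (rho x)) (fun x => k (rho x)) 2 ![s, t, 1]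
      = localFlux δ u b p (fun x => f (rho x)) (fun x => k (rho x)) 2 ![s, t, 0] := by
  have e1 := fun i => (hup.vertPeriodic i).top_eq_bottom s t
  have e2 := fun i => (hbp.vertPeriodic i).top_eq_bottom s t
  have e3 := fun i j => ((hup.vertPeriodic i).pd j).top_eq_bottom s t
  have e4 := fun i j => ((hbp.vertPeriodic i).pd j).top_eq_bottom s t
  have e5 := hpp.top_eq_bottom s t
  have z1 := stream_one (fun i => by fun_prop) hsol.2.2.1 haxu hup (x := ![s, t, 1]) rfl
  have z2 := stream_one (fun i => by fun_prop) hsol.2.2.2 haxb hbp (x := ![s, t, 1]) rfl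
  have z3 := stream_zero (u := u) (x := ![s, t, 0]) rfl
  have z4 := stream_zero (u := b) (x := ![s, t, 0]) rfl
  simp [localFlux, energyFlux, rho, dot3, hallField, cross3, curl, e1, e2, e3, e4, e5, z1, z2, z3,
    z4]

lemma continuous_cutoffSize {h : ℝ → ℝ} (hh : ContDiff ℝ (⊤ : ℕ∞) h) :
    Continuous (cutoffSize h) := by
  have c1 := (contDiff_deriv_real hh).continuous
  have c2 := (contDiff_deriv_real (contDiff_deriv_real hh)).continuous
  unfold cutoffSize
  fun_prop

/-- The localized energy inequality. -/
lemma integral_dissipation_le (hδ : δ ∈ Set.Icc (0:ℝ) 1) (hu : ContDiff ℝ (⊤ : ℕ∞) u)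
    (hb : ContDiff ℝ (⊤ : ℕ∞) b) (hp : ContDiff ℝ (⊤ : ℕ∞) p)
    (hup : PeriodicZ u) (hbp : PeriodicZ b) (hsol : IsMHD δ u b p)
    (haxu : AxiSym (compR u)) (haxb : AxiSym (compR b)) {M : ℝ} (hM : ∀ x i, |u x i| ≤ M)
    (hM' : ∀ x i, |b x i| ≤ M) {h : ℝ → ℝ} (hh : ContDiff ℝ (⊤ : ℕ∞) h) {L : ℝ}
    (hL : ∀ ρ, L < ρ → h ρ = 0) :
    ∫ x in slab, (gradSq u x + gradSq b x) * h (rho x) ≤ (36 * M + 104 * M ^ 2) *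
      ∫ x in slab, Real.sqrt (gradSq u x + gradSq b x) * cutoffSize h (rho x) := by
  have hrad := isRadial_comp_rho hh
  have hpp := vertPeriodic_pressure hu hb hp hup hbp hsol hM hM'
  have z1 := deriv_eq_zero_beyond hL
  have z2 := deriv_eq_zero_beyond z1
  have cg : Continuous fun x => gradSq u x + gradSq b x :=
    (continuous_gradSq hu).add (continuous_gradSq hb)
  have cG : Continuous fun x => (gradSq u x + gradSq b x) * h (rho x) :=
    cg.mul (hh.continuous.comp continuous_rho)
  have cR : Continuous fun x => (36 * M + 104 * M ^ 2)
      * (Real.sqrt (gradSq u x + gradSq b x) * cutoffSize h (rho x)) :=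
    continuous_const.mul (cg.sqrt.mul ((continuous_cutoffSize hh).comp continuous_rho))
  have hF := contDiff_localFlux (δ := δ) hu hb hp hrad
  have hF0 := localFlux_eq_zero (δ := δ) (u := u) (b := b) (p := p) (fun x hx => hL (rho x) hx)
    (fun x hx => by rw [z1 (rho x) hx, mul_zero] : ∀ x, L < rho x → 2 * deriv h (rho x) = 0)
  have hint := integral_div_slab hF hF0
    (localFlux_top_eq_bottom hu hb hup hbp hpp hsol haxu haxb h (fun ρ => 2 * deriv h ρ))
  have hcD := continuous_finsetSum Finset.univ fun i _ => (contDiff_pd i (hF i)).continuous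
  have hiD := integrableOn_slab hcD (L := L) fun x hx =>
    Finset.sum_eq_zero fun i _ => pd_eq_zero_of_rho_lt (hF0 i) i hx
  have hiG := integrableOn_slab cG (L := L) fun x hx => by rw [hL _ hx, mul_zero]
  have hiR := integrableOn_slab cR (L := L) fun x hx => by simp [cutoffSize, z1 _ hx, z2 _ hx]
  rw [← integral_const_mul, ← sub_zero (∫ x in slab, _ * h (rho x)), ← hint,
    ← integral_sub hiG hiD]
  refine setIntegral_mono_on (hiG.sub hiD) hiR isClosed_slab.measurableSet fun x hx => ?_
  rw [div_localFlux hu hb hp hsol hrad, sub_add_cancel_left]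
  exact (neg_le_abs _).trans (abs_energyRemainder_le hδ hu hsol haxu hM hM' h hx)

end Estimate

section Caccioppoli

/-- A smooth bump, equal to `1` on `[-1, 1]` and supported in `[-2, 2]`. -/
def annulusBump : ContDiffBump (0 : ℝ) := ⟨1, 2, by norm_num, by norm_num⟩

lemma contDiff_annulusBump : ContDiff ℝ (⊤ : ℕ∞) annulusBump := annulusBump.contDiff

lemma annulusBump_eq_zero {t : ℝ} (ht : 2 ≤ |t|) : annulusBump t = 0 :=
  annulusBump.zero_of_le_dist (by simpa [annulusBump] using ht)

lemma annulusBump_eq_one {t : ℝ} (ht : |t| ≤ 1) : annulusBump t = 1 :=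
  annulusBump.one_of_mem_closedBall (by simpa [annulusBump] using ht)

/-- The profile of the cut-off to an annulus. -/
def outerProfile (t : ℝ) : ℝ := annulusBump t ^ 4

lemma contDiff_outerProfile : ContDiff ℝ (⊤ : ℕ∞) outerProfile := contDiff_annulusBump.pow 4

lemma exists_bound_outerProfile : ∃ B > 0, ∀ t, |deriv outerProfile t| ≤ B * annulusBump t ^ 2 ∧
    |deriv (deriv outerProfile) t| ≤ B * annulusBump t ^ 2 := by
  obtain ⟨B, hB, h⟩ := exists_bound_derivs contDiff_annulusBump (a := -2) (b := 2)
  have d0 : Differentiable ℝ annulusBump := contDiff_annulusBump.differentiable (by simp)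
  have d1 : Differentiable ℝ (deriv annulusBump) :=
    (contDiff_deriv_real contDiff_annulusBump).differentiable (by simp)
  have e1 : deriv outerProfile = fun t => 4 * annulusBump t ^ 3 * deriv annulusBump t := by
    ext t
    exact ((d0 t).hasDerivAt.fun_pow 4).deriv.trans (by simp)
  have e2 : ∀ t, deriv (deriv outerProfile) t = 12 * annulusBump t ^ 2 * deriv annulusBump t ^ 2
      + 4 * annulusBump t ^ 3 * deriv (deriv annulusBump) t := by
    intro t
    rw [e1]
    have := ((((d0 t).hasDerivAt.pow 3).const_mul 4).mul (d1 t).hasDerivAt).deriv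
    refine Eq.trans ?_ (this.trans ?_)
    · rfl
    · simp
      ring
  refine ⟨12 * B ^ 2 + 4 * B, by positivity, fun t => ?_⟩
  rcases le_or_gt 2 |t| with ht | ht
  · rw [e2, e1]
    simp [annulusBump_eq_zero ht]
  · obtain ⟨b1, b2⟩ := h t (abs_le.1 ht.le)
    have z0 : 0 ≤ annulusBump t := annulusBump.nonneg
    have z1 : annulusBump t ≤ 1 := annulusBump.le_one
    rw [e2, e1]
    set z := annulusBump t
    have p3 : z ^ 3 ≤ z ^ 2 := pow_le_pow_of_le_one z0 z1 (by norm_num)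
    have a1 : |4 * z ^ 3 * deriv annulusBump t| ≤ 4 * z ^ 2 * B := by
      rw [abs_mul, abs_of_nonneg (by positivity : 0 ≤ 4 * z ^ 3)]
      gcongr
    have a2 : |4 * z ^ 3 * deriv (deriv annulusBump) t| ≤ 4 * z ^ 2 * B := by
      rw [abs_mul, abs_of_nonneg (by positivity : 0 ≤ 4 * z ^ 3)]
      gcongr
    have a3 : |12 * z ^ 2 * deriv annulusBump t ^ 2| ≤ 12 * z ^ 2 * B ^ 2 := by
      rw [abs_mul, abs_of_nonneg (by positivity : 0 ≤ 12 * z ^ 2), abs_pow]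
      gcongr
    have p1 : 0 ≤ 12 * z ^ 2 * B ^ 2 := by positivity
    constructor
    · linarith
    · refine (abs_add_le _ _).trans ?_
      linarith

variable {δ : ℝ} {u b : V3 → V3} {p : V3 → ℝ}

lemma setIntegral_shell_le {f g : V3 → ℝ} {s t : ℝ} (hf : Continuous f)
    (hg : IntegrableOn g slab) (hg0 : ∀ x, 0 ≤ g x) (hfg : ∀ x ∈ shell s t, f x ≤ g x) :
    ∫ x in shell s t, f x ≤ ∫ x in slab, g x := by
  have hsub : shell s t ⊆ slab := fun x hx => hx.1
  refine (setIntegral_mono_on (hf.continuousOn.integrableOn_compact (isCompact_shell s t))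
    (hg.mono_set hsub) (measurableSet_shell s t) hfg).trans ?_
  exact setIntegral_mono_set hg (.of_forall hg0) (LE.le.eventuallyLE hsub)

/-- The dissipation in the annulus `O_R` grows at most linearly. -/
lemma exists_dissipation_annulus_le (hδ : δ ∈ Set.Icc (0:ℝ) 1) (hu : ContDiff ℝ (⊤ : ℕ∞) u)
    (hb : ContDiff ℝ (⊤ : ℕ∞) b) (hp : ContDiff ℝ (⊤ : ℕ∞) p)
    (hup : PeriodicZ u) (hbp : PeriodicZ b) (hsol : IsMHD δ u b p)
    (haxu : AxiSym (compR u)) (haxb : AxiSym (compR b)) {M : ℝ} (hM : ∀ x i, |u x i| ≤ M)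
    (hM' : ∀ x i, |b x i| ≤ M) :
    ∃ C > 0, ∀ R ≥ (2:ℝ), ∫ x in OR R, (gradSq u x + gradSq b x) ≤ C * R := by
  obtain ⟨B, hB, hbd⟩ := exists_bound_outerProfile
  have hM0 : 0 ≤ M := (abs_nonneg _).trans (hM 0 0)
  set A := (36 * M + 104 * M ^ 2) * (7 * B) with hA
  have hA0 : 0 ≤ A := by positivity
  have hpos := unitVol_pos
  refine ⟨8 * A ^ 2 * unitVol + 1, by positivity, fun R hR => ?_⟩
  have hd : 0 < 2 * R - 1 := by linarith
  set h := cutoff outerProfile R with hh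
  have hsm : ContDiff ℝ (⊤ : ℕ∞) h := contDiff_cutoff contDiff_outerProfile R
  have hL : ∀ ρ, R ^ 2 + 2 * (2 * R - 1) < ρ → h ρ = 0 := fun ρ =>
    cutoff_eq_zero (fun t ht => by
      simp [outerProfile, annulusBump_eq_zero (ht.le.trans (le_abs_self t))]) hR
  have z1 := deriv_eq_zero_beyond hL
  have z2 := deriv_eq_zero_beyond z1
  have hsize : ∀ ρ, cutoffSize h ρ ≤ 7 * (B * cutoff annulusBump R ρ ^ 2) := fun ρ =>
    cutoffSize_le contDiff_outerProfile (fun t => (hbd t).1) (fun t => (hbd t).2)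
      (fun t ht => by simp [annulusBump_eq_zero (ht.le.trans (le_abs_self t))]) hR
  have cg : Continuous fun x => gradSq u x + gradSq b x :=
    (continuous_gradSq hu).add (continuous_gradSq hb)
  have g0 : ∀ x, 0 ≤ gradSq u x + gradSq b x := fun x =>
    add_nonneg (gradSq_nonneg u x) (gradSq_nonneg b x)
  have hiG : IntegrableOn (fun x => (gradSq u x + gradSq b x) * h (rho x)) slab :=
    integrableOn_slab (cg.mul (hsm.continuous.comp continuous_rho))
    (L := R ^ 2 + 2 * (2 * R - 1)) fun x hx => by simp [hL _ hx]
  have hiS : IntegrableOn (fun x => Real.sqrt (gradSq u x + gradSq b x)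
      * cutoffSize h (rho x)) slab := integrableOn_slab
    (cg.sqrt.mul ((continuous_cutoffSize hsm).comp continuous_rho))
    (L := R ^ 2 + 2 * (2 * R - 1)) fun x hx => by simp [cutoffSize, z1 _ hx, z2 _ hx]
  have hh0 : ∀ ρ, 0 ≤ h ρ := fun ρ => pow_nonneg annulusBump.nonneg 4
  have hle : ∫ x in OR R, (gradSq u x + gradSq b x)
      ≤ ∫ x in slab, (gradSq u x + gradSq b x) * h (rho x) := by
    rw [OR_eq_shell (by linarith)]
    refine setIntegral_shell_le cg hiG (fun x => mul_nonneg (g0 x) (hh0 _)) fun x hx => ?_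
    have : h (rho x) = 1 := by
      rw [hh, cutoff, outerProfile, annulusBump_eq_one, one_pow]
      rw [abs_div, abs_of_pos hd, div_le_one hd, abs_le]
      constructor <;> nlinarith [hx.2.1, hx.2.2]
    rw [this, mul_one]
  have hvol := volume_shell_le (a := R ^ 2 - 2 * (2 * R - 1)) (b := R ^ 2 + 2 * (2 * R - 1))
    (by linarith) (by positivity)
  have henergy := integral_dissipation_le hδ hu hb hp hup hbp hsol haxu haxb hM hM' hsm hL
  set T := shell (R ^ 2 - 2 * (2 * R - 1)) (R ^ 2 + 2 * (2 * R - 1)) with hT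
  have hyoung : (36 * M + 104 * M ^ 2) *
      ∫ x in slab, Real.sqrt (gradSq u x + gradSq b x) * cutoffSize h (rho x)
      ≤ 1 / 2 * (∫ x in slab, (gradSq u x + gradSq b x) * h (rho x))
        + A ^ 2 / 2 * volume.real T := by
    rw [← integral_const_mul, ← integral_const_mul, ← integral_indicator_shell,
      ← integral_add (hiG.const_mul _) (integrableOn_indicator_shell continuous_const _ _)]
    refine setIntegral_mono_on (hiS.const_mul _) ((hiG.const_mul _).add
      (integrableOn_indicator_shell continuous_const _ _)) isClosed_slab.measurableSet
      fun x hx => ?_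
    set z := cutoff annulusBump R (rho x) with hz
    set g := Real.sqrt (gradSq u x + gradSq b x) with hg
    have hg0 : 0 ≤ g := Real.sqrt_nonneg _
    have hgg : gradSq u x + gradSq b x = g ^ 2 := (Real.sq_sqrt (g0 x)).symm
    have hhz : h (rho x) = z ^ 4 := rfl
    have h1 : (36 * M + 104 * M ^ 2) * (g * cutoffSize h (rho x)) ≤ A * (g * z ^ 2) := by
      calc _ ≤ (36 * M + 104 * M ^ 2) * (g * (7 * (B * z ^ 2))) := by
            gcongr
            exact hsize _
        _ = _ := by rw [hA]; ring
    refine h1.trans ?_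
    rw [hgg, hhz]
    by_cases hxT : x ∈ T
    · rw [Set.indicator_of_mem hxT]
      nlinarith [sq_nonneg (g * z ^ 2 - A)]
    · rw [Set.indicator_of_notMem hxT]
      have : z = 0 := by
        refine annulusBump_eq_zero ?_
        by_contra! hlt
        rw [abs_div, abs_of_pos hd, div_lt_iff₀ hd, abs_lt] at hlt
        exact hxT ⟨hx, by linarith [hlt.1], by linarith [hlt.2]⟩
      simp [this]
  have h3 : A ^ 2 * volume.real T ≤ A ^ 2 * (8 * R * unitVol) := by
    gcongr
    refine hvol.trans ?_
    gcongr
    linarith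
  nlinarith

end Caccioppoli

section SaintVenant

lemma sq_setIntegral_sqrt_le {f : V3 → ℝ} (hf : Continuous f) (hf0 : ∀ x, 0 ≤ f x) (s t : ℝ) :
    (∫ x in shell s t, Real.sqrt (f x)) ^ 2
      ≤ (∫ x in shell s t, f x) * volume.real (shell s t) := by
  have hi := fun {g : V3 → ℝ} (hg : Continuous g) =>
    hg.continuousOn.integrableOn_compact (μ := volume) (isCompact_shell s t)
  have key : ∀ c : ℝ, 0 ≤ volume.real (shell s t) * (c * c)
      + (-2 * ∫ x in shell s t, Real.sqrt (f x)) * c + ∫ x in shell s t, f x := by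
    intro c
    have h1 : ∫ x in shell s t, (Real.sqrt (f x) - c) ^ 2 = ∫ x in shell s t,
        (f x - 2 * c * Real.sqrt (f x) + c * c) := by
      congr 1
      ext x
      linear_combination Real.sq_sqrt (hf0 x)
    have h2 : 0 ≤ ∫ x in shell s t, (Real.sqrt (f x) - c) ^ 2 :=
      integral_nonneg fun x => sq_nonneg _
    rw [h1, integral_add (hi (by fun_prop)) (hi (by fun_prop)),
      integral_sub (hi hf) (hi (by fun_prop)), integral_const_mul, setIntegral_const] at h2
    rw [smul_eq_mul] at h2
    linarith
  have := discrim_le_zero key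
  rw [discrim] at this
  linarith

lemma phiR_le (R : ℝ) (hR : 2 ≤ R) {x : V3} (hx : x ∈ slab) :
    phiR R x ≤ cutoff innerProfile R (rho x) + (OR R).indicator (fun _ => 1) x := by
  have h0 : 0 ≤ cutoff innerProfile R (rho x) := innerProfile_nonneg _
  have hle : phiR R x ≤ 1 := min_le_left _ _
  by_cases hxR : x ∈ OR R
  · rw [Set.indicator_of_mem hxR]
    linarith
  · rw [Set.indicator_of_notMem hxR, add_zero]
    rcases le_or_gt R (nr x) with h | h
    · rwa [phiR_eq_zero h]
    · have h1 : nr x < R - 1 := by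
        by_contra! h1
        exact hxR ⟨hx, h1, h.le⟩
      rwa [cutoff_innerProfile_eq_one hR]
      rw [nr_eq] at h1
      exact ((Real.sqrt_lt' (by linarith)).1 h1).le

end SaintVenant

/-- Saint-Venant differential inequality
`Y ≤ C R^{1/2} (Y')^{1/2}` under axisymmetry of the radial components. -/
theorem saint_venant_radial (δ : ℝ) (hδ : δ ∈ Set.Icc (0:ℝ) 1)
    (u b : V3 → V3) (p : V3 → ℝ)
    (hu : ContDiff ℝ (⊤ : ℕ∞) u) (hb : ContDiff ℝ (⊤ : ℕ∞) b) (hp : ContDiff ℝ (⊤ : ℕ∞) p)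
    (hubd : Bounded3 u) (hbbd : Bounded3 b)
    (hup : PeriodicZ u) (hbp : PeriodicZ b)
    (hsol : IsMHD δ u b p)
    (haxu : AxiSym (compR u)) (haxb : AxiSym (compR b))
    (Y : ℝ → ℝ)
    (hY : ∀ R : ℝ, Y R = ∫ x in slab, (gradSq u x + gradSq b x) * phiR R x) :
    ∃ C > (0:ℝ), ∀ R ≥ (2:ℝ),
      Y R ≤ C * Real.sqrt R * Real.sqrt (deriv Y R) := by
  obtain ⟨M₁, hM₁⟩ := hubd
  obtain ⟨M₂, hM₂⟩ := hbbd
  set M := max M₁ M₂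
  have hM : ∀ x i, |u x i| ≤ M := fun x i =>
    (norm_le_pi_norm (u x) i).trans ((hM₁ x).trans (le_max_left _ _))
  have hM' : ∀ x i, |b x i| ≤ M := fun x i =>
    (norm_le_pi_norm (b x) i).trans ((hM₂ x).trans (le_max_right _ _))
  have hM0 : 0 ≤ M := (abs_nonneg _).trans (hM 0 0)
  obtain ⟨C₁, hC₁, hann⟩ :=
    exists_dissipation_annulus_le hδ hu hb hp hup hbp hsol haxu haxb hM hM'
  obtain ⟨B, hB, hcut⟩ := exists_cutoffSize_inner
  have hpos := unitVol_pos
  set K := 36 * M + 104 * M ^ 2 with hK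
  have hK0 : 0 ≤ K := by positivity
  have cg : Continuous fun x => gradSq u x + gradSq b x :=
    (continuous_gradSq hu).add (continuous_gradSq hb)
  have g0 : ∀ x, 0 ≤ gradSq u x + gradSq b x := fun x =>
    add_nonneg (gradSq_nonneg u x) (gradSq_nonneg b x)
  refine ⟨K * B * Real.sqrt (2 * unitVol) + Real.sqrt C₁, by positivity, fun R hR => ?_⟩
  have hderiv : deriv Y R = ∫ x in OR R, (gradSq u x + gradSq b x) := by
    rw [funext hY]
    exact (hasDerivAt_integral_phiR cg (by linarith)).deriv
  have hD := hann R hR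
  rw [hderiv, hY]
  have hOR : OR R = shell ((R - 1) ^ 2) (R ^ 2) := OR_eq_shell (by linarith)
  have hD0 : 0 ≤ ∫ x in OR R, (gradSq u x + gradSq b x) := integral_nonneg g0
  set h := cutoff innerProfile R with hh
  have hsm : ContDiff ℝ (⊤ : ℕ∞) h := contDiff_cutoff contDiff_innerProfile R
  have hL : ∀ ρ, R ^ 2 < ρ → h ρ = 0 := fun ρ => cutoff_innerProfile_eq_zero hR
  have z1 := deriv_eq_zero_beyond hL
  have z2 := deriv_eq_zero_beyond z1
  have henergy := integral_dissipation_le hδ hu hb hp hup hbp hsol haxu haxb hM hM' hsm hL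
  have hiG : IntegrableOn (fun x => (gradSq u x + gradSq b x) * h (rho x)) slab :=
    integrableOn_slab (cg.mul (hsm.continuous.comp continuous_rho))
    (L := R ^ 2) fun x hx => by simp [hL _ hx]
  have hiS : IntegrableOn (fun x => Real.sqrt (gradSq u x + gradSq b x)
      * cutoffSize h (rho x)) slab := integrableOn_slab
    (cg.sqrt.mul ((continuous_cutoffSize hsm).comp continuous_rho))
    (L := R ^ 2) fun x hx => by simp [cutoffSize, z1 _ hx, z2 _ hx]
  have hiφ : IntegrableOn (fun x => (gradSq u x + gradSq b x) * phiR R x) slab :=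
    integrableOn_slab (cg.mul (continuous_phiR R)) (L := R ^ 2) fun x hx => by
    rw [phiR_eq_zero, mul_zero]
    exact Real.le_sqrt_of_sq_le hx.le
  have hiO : ∀ {f : V3 → ℝ}, Continuous f → IntegrableOn ((OR R).indicator f) slab := fun hf => by
    rw [hOR]
    exact integrableOn_indicator_shell hf _ _
  have hO : ∀ f : V3 → ℝ, ∫ x in slab, (OR R).indicator f x = ∫ x in OR R, f x := fun f => by
    rw [hOR, setIntegral_indicator (measurableSet_shell _ _),
      Set.inter_eq_right.2 fun x hx => hx.1]
  have hsplit : ∫ x in slab, (gradSq u x + gradSq b x) * phiR R x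
      ≤ (∫ x in slab, (gradSq u x + gradSq b x) * h (rho x))
        + ∫ x in OR R, (gradSq u x + gradSq b x) := by
    rw [← hO, ← integral_add hiG (hiO cg)]
    refine setIntegral_mono_on hiφ (hiG.add (hiO cg)) isClosed_slab.measurableSet fun x hx => ?_
    refine (mul_le_mul_of_nonneg_left (phiR_le R hR hx) (g0 x)).trans (le_of_eq ?_)
    by_cases hxR : x ∈ OR R <;> simp [hxR, mul_add, hh]
  have hsqrt : ∫ x in slab, Real.sqrt (gradSq u x + gradSq b x) * cutoffSize h (rho x)
      ≤ B * ∫ x in OR R, Real.sqrt (gradSq u x + gradSq b x) := by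
    rw [← integral_const_mul, ← hO]
    refine setIntegral_mono_on hiS (hiO (by fun_prop)) isClosed_slab.measurableSet fun x hx => ?_
    refine (mul_le_mul_of_nonneg_left (hcut R hR x hx) (Real.sqrt_nonneg _)).trans (le_of_eq ?_)
    by_cases hxR : x ∈ OR R <;> simp [hxR, mul_comm]
  have hCS : ∫ x in OR R, Real.sqrt (gradSq u x + gradSq b x) ≤ Real.sqrt (2 * unitVol)
      * Real.sqrt R * Real.sqrt (∫ x in OR R, (gradSq u x + gradSq b x)) := by
    rw [← Real.sqrt_mul (by positivity), ← Real.sqrt_mul (by positivity)]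
    refine Real.le_sqrt_of_sq_le ?_
    have h1 := sq_setIntegral_sqrt_le cg g0 ((R - 1) ^ 2) (R ^ 2)
    rw [← hOR] at h1
    refine h1.trans ?_
    rw [mul_comm]
    gcongr
    exact (volume_OR_le hR).trans (le_of_eq (by ring))
  have hDD : ∫ x in OR R, (gradSq u x + gradSq b x) ≤ Real.sqrt C₁ * Real.sqrt R
      * Real.sqrt (∫ x in OR R, (gradSq u x + gradSq b x)) := by
    nth_rw 1 [← Real.mul_self_sqrt hD0]
    rw [← Real.sqrt_mul hC₁.le]
    gcongr
  set D := ∫ x in OR R, (gradSq u x + gradSq b x)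
  calc _ ≤ K * (B * (Real.sqrt (2 * unitVol) * Real.sqrt R * Real.sqrt D))
          + Real.sqrt C₁ * Real.sqrt R * Real.sqrt D := by
        refine hsplit.trans (add_le_add (henergy.trans ?_) hDD)
        gcongr
        exact hsqrt.trans (by gcongr)
    _ = _ := by ring
end Pressure
end
end

section
/- Let C > 0 and R₀ > 0, and let Y : [R₀, ∞) → ℝ be differentiable, nonnegative, and nondecreasing, satisfying Y(R)² ≤ C² R Y'(R) for all R ≥ R₀. Then Y(R) = 0 for all R ≥ R₀. -/
open MeasureTheory

noncomputable section

/-- A nonnegative nondecreasing differentiable function satisfying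
`Y² ≤ C² R Y'` on `[R₀, ∞)` vanishes identically. -/
theorem ode_vanishing (C R₀ : ℝ) (hC : 0 < C) (hR₀ : 0 < R₀) (Y : ℝ → ℝ)
    (hdiff : ∀ R ≥ R₀, DifferentiableAt ℝ Y R)
    (hnonneg : ∀ R ≥ R₀, 0 ≤ Y R)
    (hmono : MonotoneOn Y (Set.Ici R₀))
    (hineq : ∀ R ≥ R₀, (Y R) ^ 2 ≤ C ^ 2 * R * deriv Y R) :
    ∀ R ≥ R₀, Y R = 0 := by
  intro R₁ hR₁
  by_contra hne
  have hpos : ∀ R ≥ R₁, 0 < Y R := fun R hR =>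
    lt_of_lt_of_le (lt_of_le_of_ne (hnonneg R₁ hR₁) (Ne.symm hne))
      (hmono hR₁ (ge_trans hR hR₁) hR)
  have hR₁pos : 0 < R₁ := lt_of_lt_of_le hR₀ hR₁
  have hderiv : ∀ R ≥ R₁, HasDerivAt (fun r => C ^ 2 * (Y r)⁻¹ + Real.log r)
      (C ^ 2 * (-deriv Y R / Y R ^ 2) + R⁻¹) R := fun R hR =>
    (((hdiff R (ge_trans hR hR₁)).hasDerivAt.inv (hpos R hR).ne').const_mul (C ^ 2)).add
      (Real.hasDerivAt_log (lt_of_lt_of_le hR₁pos hR).ne')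
  have hanti : AntitoneOn (fun r => C ^ 2 * (Y r)⁻¹ + Real.log r) (Set.Ici R₁) := by
    refine antitoneOn_of_deriv_nonpos (convex_Ici R₁)
      (fun R hR => (hderiv R hR).continuousAt.continuousWithinAt)
      (fun R hR => (hderiv R (interior_subset hR)).differentiableAt.differentiableWithinAt) ?_
    intro R hR
    have hR' : R ≥ R₁ := interior_subset hR
    have hRpos : 0 < R := lt_of_lt_of_le hR₁pos hR'
    have hYpos := hpos R hR'
    rw [(hderiv R hR').deriv]
    have h : R⁻¹ ≤ C ^ 2 * deriv Y R / Y R ^ 2 := by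
      rw [le_div_iff₀ (by positivity), inv_mul_le_iff₀ hRpos]
      linarith [hineq R (ge_trans hR' hR₁)]
    rw [neg_div, mul_neg, ← mul_div_assoc]
    linarith
  obtain ⟨R, hRlog, hR⟩ := ((Real.tendsto_log_atTop.eventually_gt_atTop
    (C ^ 2 * (Y R₁)⁻¹ + Real.log R₁)).and (Filter.eventually_ge_atTop R₁)).exists
  have hle := hanti Set.self_mem_Ici hR hR
  have hterm : 0 < C ^ 2 * (Y R)⁻¹ := mul_pos (pow_pos hC 2) (inv_pos.mpr (hpos R hR))
  dsimp only at hle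
  linarith
end
end

section
/- Let C₁, C₂ > 0 and R₀ > 0, and let Y : [R₀, ∞) → ℝ be differentiable and nondecreasing with Y(R₀) ≥ 4C₂², satisfying Y(R) ≤ C₁ Y'(R) + C₂ R^{1/2} (Y'(R))^{1/2} for all R ≥ R₀. Then Y(2R) ≥ Y(R) · exp(R / (8C₁)) for all R ≥ R₀. -/
open MeasureTheory

noncomputable section

/-- Completing the square in `y ≤ a d + b √r √d` removes the square roots. -/
theorem sq_le_mul_of_le_add_sqrt {a b r d y : ℝ} (ha : 0 < a) (hr : 0 ≤ r) (hy : 0 < y)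
    (h : y ≤ a * d + b * √r * √d) : y ^ 2 ≤ (b ^ 2 * r + 2 * a * y) * d := by
  have hd : 0 ≤ d := by
    by_contra! hd
    rw [Real.sqrt_eq_zero_of_nonpos hd.le] at h
    nlinarith
  have hs : (b * √r * √d) ^ 2 = b ^ 2 * r * d := by
    rw [mul_pow, mul_pow, Real.sq_sqrt hr, Real.sq_sqrt hd]
  have had : 0 ≤ a * d := by positivity
  rcases le_total (a * d) y with hle | hle
  · nlinarith [pow_le_pow_left₀ (sub_nonneg.2 hle) (sub_le_iff_le_add'.2 h) 2]
  · nlinarith [mul_le_mul_of_nonneg_right hle hy.le, sq_nonneg (b * √r * √d)]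

/-- Exponential growth from the Saint-Venant differential inequality
when `Y(R₀) ≥ 4C₂²`. -/
theorem ode_exponential_growth (C₁ C₂ R₀ : ℝ) (hC₁ : 0 < C₁) (hC₂ : 0 < C₂)
    (hR₀ : 0 < R₀) (Y : ℝ → ℝ)
    (hdiff : ∀ R ≥ R₀, DifferentiableAt ℝ Y R)
    (hmono : MonotoneOn Y (Set.Ici R₀))
    (hY₀ : Y R₀ ≥ 4 * C₂ ^ 2)
    (hineq : ∀ R ≥ R₀, Y R ≤ C₁ * deriv Y R + C₂ * Real.sqrt R * Real.sqrt (deriv Y R)) :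
    ∀ R ≥ R₀, Y (2 * R) ≥ Y R * Real.exp (R / (8 * C₁)) := by
  intro R hR
  have hRpos : 0 < R := hR₀.trans_le hR
  have hlow : ∀ r ≥ R₀, 4 * C₂ ^ 2 ≤ Y r := fun r hr =>
    hY₀.le.trans (hmono Set.self_mem_Ici hr hr)
  have hpos : ∀ r ≥ R₀, 0 < Y r := fun r hr => lt_of_lt_of_le (by positivity) (hlow r hr)
  have hge : ∀ r ∈ Set.Icc R (2 * R), r ≥ R₀ := fun r hr => hR.trans hr.1
  have h2R : 2 * R ≥ R₀ := by linarith
  let F : ℝ → ℝ := fun r => 2 * C₁ * Real.log (Y r) - 2 * C₂ ^ 2 * R * (Y r)⁻¹ - r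
  have hF : ∀ r ≥ R₀, HasDerivAt F
      (2 * C₁ * (deriv Y r / Y r) - 2 * C₂ ^ 2 * R * (-deriv Y r / Y r ^ 2) - 1) r := by
    intro r hr
    have hY := (hdiff r hr).hasDerivAt
    have hne := (hpos r hr).ne'
    exact (((hY.log hne).const_mul _).sub ((hY.inv hne).const_mul _)).sub (hasDerivAt_id r)
  have hFmono : MonotoneOn F (Set.Icc R (2 * R)) := by
    refine monotoneOn_of_deriv_nonneg (convex_Icc _ _)
      (fun r hr => (hF r (hge r hr)).continuousAt.continuousWithinAt)
      (fun r hr => (hF r (hge r (interior_subset hr))).differentiableAt.differentiableWithinAt)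
      fun r hr => ?_
    have hr := interior_subset hr
    have hy := hpos r (hge r hr)
    have hr0 : 0 ≤ r := hRpos.le.trans hr.1
    rw [(hF r (hge r hr)).deriv]
    have hsq := sq_le_mul_of_le_add_sqrt hC₁ hr0 hy (hineq r (hge r hr))
    have hd : 0 ≤ deriv Y r :=
      (pos_of_mul_pos_right ((sq_pos_of_pos hy).trans_le hsq) (by positivity)).le
    have hle : C₂ ^ 2 * r * deriv Y r ≤ C₂ ^ 2 * (2 * R) * deriv Y r := by
      gcongr
      exact hr.2
    have heq : 2 * C₁ * (deriv Y r / Y r) - 2 * C₂ ^ 2 * R * (-deriv Y r / Y r ^ 2) - 1 =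
        ((2 * C₂ ^ 2 * R + 2 * C₁ * Y r) * deriv Y r - Y r ^ 2) / Y r ^ 2 := by
      field_simp
      ring
    rw [heq]
    exact div_nonneg (by linarith) (by positivity)
  have hle : F R ≤ F (2 * R) :=
    hFmono (Set.left_mem_Icc.2 (by linarith)) (Set.right_mem_Icc.2 (by linarith)) (by linarith)
  have hinit : 2 * C₂ ^ 2 * R * (Y R)⁻¹ ≤ R / 2 := by
    rw [← div_eq_mul_inv, div_le_iff₀ (hpos R hR)]
    nlinarith [hlow R hR]
  have hend : 0 ≤ 2 * C₂ ^ 2 * R * (Y (2 * R))⁻¹ := by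
    have := hpos _ h2R
    positivity
  have hlog : Real.log (Y R) + R / (8 * C₁) ≤ Real.log (Y (2 * R)) := by
    rw [← le_sub_iff_add_le', div_le_iff₀ (by positivity)]
    simp only [F] at hle
    linarith
  have hexp := Real.exp_le_exp.2 hlog
  rwa [Real.exp_add, Real.exp_log (hpos R hR), Real.exp_log (hpos _ h2R)] at hexp
end
end

section
/- Let C₁, C₂, C₃ > 0 and α > 0, and let Y : (1, ∞) → ℝ be differentiable, nonnegative, and nondecreasing, satisfying Y(R) ≤ C₁ Y'(R) + C₂ R^{1/2} (Y'(R))^{1/2} for all R > 1 and Y(R) ≤ C₃ R^α for all R > 1. Then Y(R) = 0 for all R > 1. -/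
open MeasureTheory

noncomputable section

/-- A differential inequality `k f ≤ x f'` on `[a, ∞)` forces growth of order at least `x ^ k`. -/
lemma rpow_growth_of_mul_le_mul_deriv {f : ℝ → ℝ} {a k : ℝ} (ha : 0 < a)
    (hf : ∀ x ≥ a, DifferentiableAt ℝ f x) (hk : ∀ x ≥ a, k * f x ≤ x * deriv f x) :
    ∀ x ≥ a, f a * a ^ (-k) * x ^ k ≤ f x := by
  have hd : ∀ x ≥ a, HasDerivAt (fun x => f x * x ^ (-k))
      (deriv f x * x ^ (-k) + f x * (-k * x ^ (-k - 1))) x := fun x hx =>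
    (hf x hx).hasDerivAt.mul (Real.hasDerivAt_rpow_const (Or.inl (ha.trans_le hx).ne'))
  have hmono : MonotoneOn (fun x => f x * x ^ (-k)) (Set.Ici a) := by
    refine monotoneOn_of_deriv_nonneg (convex_Ici a)
      (fun x hx => (hd x hx).continuousAt.continuousWithinAt)
      (fun x hx => (hd x (interior_subset hx)).differentiableAt.differentiableWithinAt) ?_
    intro x hx
    have hxa : a ≤ x := interior_subset hx
    have hx0 : 0 < x := ha.trans_le hxa
    rw [(hd x hxa).deriv]
    have hsplit : x ^ (-k) = x * x ^ (-k - 1) := by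
      rw [Real.rpow_sub_one hx0.ne']
      field_simp
    rw [hsplit]
    have := mul_nonneg (sub_nonneg.2 (hk x hxa)) (Real.rpow_nonneg hx0.le (-k - 1))
    linarith
  intro x hx
  have hx0 : 0 < x := ha.trans_le hx
  calc f a * a ^ (-k) * x ^ k ≤ f x * x ^ (-k) * x ^ k :=
        mul_le_mul_of_nonneg_right (hmono Set.self_mem_Ici hx hx) (Real.rpow_nonneg hx0.le k)
    _ = f x := by rw [mul_assoc, ← Real.rpow_add hx0]; simp

/-- Solving the Saint-Venant inequality `y ≤ C₁ d + C₂ √(R d)` for a lower bound on `d`. -/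
lemma mul_le_mul_of_saint_venant {C₁ C₂ k R y d : ℝ} (hC₁ : 0 < C₁) (hC₂ : 0 < C₂)
    (hR : 0 < R) (hy : 0 < y) (hRk : 4 * k * C₁ ≤ R) (hyk : 4 * k * C₂ ^ 2 ≤ y)
    (h : y ≤ C₁ * d + C₂ * √R * √d) : k * y ≤ R * d := by
  by_contra! hlt
  have hlin : C₁ * d < y / 4 := by
    have h₁ := mul_lt_mul_of_pos_left hlt hC₁
    have h₂ := mul_le_mul_of_nonneg_right hRk hy.le
    refine lt_of_mul_lt_mul_left ?_ hR.le
    linarith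
  have hroot : C₂ * √R * √d ≤ y / 2 := by
    rw [mul_assoc, ← Real.sqrt_mul hR.le, ← le_div_iff₀' hC₂]
    refine Real.sqrt_le_iff.2 ⟨by positivity, ?_⟩
    rw [div_pow, le_div_iff₀ (by positivity)]
    have h₁ := mul_lt_mul_of_pos_right hlt (pow_pos hC₂ 2)
    have h₂ := mul_le_mul_of_nonneg_right hyk hy.le
    linarith
  linarith

/-- A nonnegative nondecreasing differentiable function satisfying
the Saint-Venant inequality and polynomial growth on `(1, ∞)` vanishes identically. -/
theorem ode_vanishing_polynomial_growth (C₁ C₂ C₃ α : ℝ)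
    (hC₁ : 0 < C₁) (hC₂ : 0 < C₂) (hC₃ : 0 < C₃) (hα : 0 < α) (Y : ℝ → ℝ)
    (hdiff : ∀ R > (1:ℝ), DifferentiableAt ℝ Y R)
    (hnonneg : ∀ R > (1:ℝ), 0 ≤ Y R)
    (hmono : MonotoneOn Y (Set.Ioi 1))
    (hineq : ∀ R > (1:ℝ),
      Y R ≤ C₁ * deriv Y R + C₂ * Real.sqrt R * Real.sqrt (deriv Y R))
    (hgrow : ∀ R > (1:ℝ), Y R ≤ C₃ * R ^ α) :
    ∀ R > (1:ℝ), Y R = 0 := by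
  intro R₀ hR₀
  by_contra hne
  have hY₀ : 0 < Y R₀ := lt_of_le_of_ne (hnonneg R₀ hR₀) (Ne.symm hne)
  have hgrowth : ∀ k a : ℝ, R₀ ≤ a → 4 * k * C₁ ≤ a → 4 * k * C₂ ^ 2 ≤ Y a →
      ∀ x ≥ a, Y a * a ^ (-k) * x ^ k ≤ Y x := by
    intro k a ha hka hYa
    have ha1 : 1 < a := hR₀.trans_le ha
    refine rpow_growth_of_mul_le_mul_deriv (by linarith)
      (fun x hx => hdiff x (ha1.trans_le hx)) fun x hx => ?_
    have hx1 : 1 < x := ha1.trans_le hx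
    exact mul_le_mul_of_saint_venant hC₁ hC₂ (by linarith)
      (hY₀.trans_le (hmono hR₀ hx1 (ha.trans hx))) (hka.trans hx)
      (hYa.trans (hmono ha1 hx1 hx)) (hineq x hx1)
  have hunbounded : Filter.Tendsto Y Filter.atTop Filter.atTop := by
    obtain ⟨k, hk, hkY⟩ : ∃ k > 0, 4 * k * C₂ ^ 2 ≤ Y R₀ :=
      ⟨Y R₀ / (4 * C₂ ^ 2), by positivity, le_of_eq (by field_simp)⟩
    set a := max R₀ (4 * k * C₁)
    have ha : R₀ ≤ a := le_max_left _ _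
    have ha1 : 1 < a := hR₀.trans_le ha
    have hYa : Y R₀ ≤ Y a := hmono hR₀ ha1 ha
    have hc : 0 < Y a * a ^ (-k) :=
      mul_pos (hY₀.trans_le hYa) (Real.rpow_pos_of_pos (by linarith) _)
    refine Filter.tendsto_atTop_mono' _ ?_ ((tendsto_rpow_atTop hk).const_mul_atTop hc)
    filter_upwards [Filter.eventually_ge_atTop a] with x hx
    exact hgrowth k a ha (le_max_right _ _) (hkY.trans hYa) x hx
  obtain ⟨a, ha, hka, hYa⟩ := ((Filter.eventually_ge_atTop R₀).and
    ((Filter.eventually_ge_atTop (4 * (α + 1) * C₁)).and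
      (hunbounded.eventually_ge_atTop (4 * (α + 1) * C₂ ^ 2)))).exists
  have ha1 : 1 < a := hR₀.trans_le ha
  have hc : 0 < Y a * a ^ (-(α + 1)) :=
    mul_pos (hY₀.trans_le (hmono hR₀ ha1 ha)) (Real.rpow_pos_of_pos (by linarith) _)
  obtain ⟨x, hxa, hx⟩ := ((Filter.eventually_ge_atTop a).and
    ((Filter.tendsto_id.const_mul_atTop hc).eventually_gt_atTop C₃)).exists
  have hx1 : 1 < x := ha1.trans_le hxa
  have hx0 : 0 < x := by linarith
  have hle := (hgrowth (α + 1) a ha hka hYa x hxa).trans (hgrow x hx1)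
  rw [Real.rpow_add_one hx0.ne', mul_comm (x ^ α), ← mul_assoc] at hle
  exact absurd (le_of_mul_le_mul_right hle (Real.rpow_pos_of_pos hx0 α)) (not_le.2 hx)
end
end
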